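/- Let 0 < p < ∞, 0 < s < 2/p and 1/τ = s/2 + 1/p, and assume τ < 1. There exists a constant c > 0, depending only on s, p and the structural parameters N₀, c₀, β, such that for every n ≥ n₀ and all S₁, S₂ ∈ S(n,1): |S₁|_{B^{s,1}_τ}^τ ≤ |S₂|_{B^{s,1}_τ}^τ + c · n^{τs/2} · ‖S₁ − S₂‖_{L^p(Ω)}^τ. -/

import Mathlib

open scoped Classical

open Set Metric MeasureTheory ENNReal

noncomputable section

/-- The Euclidean plane `ℝ²`. -/
abbrev Plane : Type := EuclideanSpace ℝ (Fin 2)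

/-- `Q` is a compact regular convex set whose boundary is a polygon consisting of at most
`N₀` line segments, with eccentricity bounded by `c₀`. -/
def IsRegularConvexPolygon (N₀ : ℕ) (c₀ : ℝ) (Q : Set Plane) : Prop :=
  IsCompact Q ∧ Convex ℝ Q ∧ Q.Nonempty ∧
    (∃ (m : ℕ) (v w : Fin m → Plane), m ≤ N₀ ∧ frontier Q = ⋃ i, segment ℝ (v i) (w i)) ∧
    (∃ (x₁ x₂ : Plane) (r₁ r₂ : ℝ), 0 < r₂ ∧
      closedBall x₂ r₂ ⊆ Q ∧ Q ⊆ closedBall x₁ r₁ ∧ r₁ ≤ c₀ * r₂)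

/-- There is a triangle contained in `R` having the segment `[a,b]` as a side, whose two
angles adjacent to that side are equal to `β`. -/
def HasGoodTriangle (β : ℝ) (R : Set Plane) (a b : Plane) : Prop :=
  ∃ c : Plane, convexHull ℝ {a, b, c} ⊆ R ∧
    EuclideanGeometry.angle b a c = β ∧ EuclideanGeometry.angle a b c = β

/-- `R ⊆ ℝ²` is a ring with structural parameters `N₀`, `c₀`, `β`: the difference of two
regular compact convex sets with polygonal boundaries, admitting no uncontrollably narrow
elongated subregions (each maximal edge of the boundary can be subdivided into at most two
segments, each carrying a good triangle with adjacent angles `β` inside `R`). -/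
def IsRing (N₀ : ℕ) (c₀ β : ℝ) (R : Set Plane) : Prop :=
  (∃ Q₁ Q₂ : Set Plane,
      IsRegularConvexPolygon N₀ c₀ Q₁ ∧
      (Q₂ = ∅ ∨ (Q₂ ⊆ Q₁ ∧ IsRegularConvexPolygon N₀ c₀ Q₂)) ∧
      R = Q₁ \ interior Q₂) ∧
  (∃ (m : ℕ) (v w : Fin m → Plane),
      frontier R = ⋃ i, segment ℝ (v i) (w i) ∧
      (∀ i, ∀ a b : Plane, segment ℝ (v i) (w i) ⊆ segment ℝ a b →
        segment ℝ a b ⊆ frontier R → segment ℝ a b = segment ℝ (v i) (w i)) ∧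
      (∀ i, ∃ p ∈ segment ℝ (v i) (w i),
        HasGoodTriangle β R (v i) p ∧ HasGoodTriangle β R p (w i)))

/-- `Ω` is the union of `n` rings with pairwise disjoint interiors. -/
def IsRingDecomp (N₀ : ℕ) (c₀ β : ℝ) (n : ℕ) (Ω : Set Plane) : Prop :=
  ∃ R : Fin n → Set Plane,
    (∀ j, IsRing N₀ c₀ β (R j)) ∧
    (∀ i j, i ≠ j → interior (R i) ∩ interior (R j) = ∅) ∧
    (⋃ j, R j) = Ω

/-- Membership in the nonlinear spline class `S(n,k)`: piecewise polynomials of total degree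
`< k` over `n` rings with pairwise disjoint interiors whose union is `Ω` (or, when `Ω = ℝ²`,
whose union -- the support of the spline -- is itself a ring), having maximum smoothness
`W^{k-2}(Ω)` when `k ≥ 2` (no smoothness is required for piecewise constants, `k = 1`). -/
def IsSpline (N₀ : ℕ) (c₀ β : ℝ) (n k : ℕ) (Ω : Set Plane) (S : Plane → ℝ) : Prop :=
  ∃ (R : Fin n → Set Plane) (P : Fin n → MvPolynomial (Fin 2) ℝ),
    (∀ j, IsRing N₀ c₀ β (R j)) ∧
    (∀ i j, i ≠ j → interior (R i) ∩ interior (R j) = ∅) ∧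
    ((⋃ j, R j) = Ω ∨ (Ω = Set.univ ∧ IsRing N₀ c₀ β (⋃ j, R j))) ∧
    (∀ j, (P j).totalDegree < k) ∧
    (S = fun x => ∑ j, (R j).indicator (fun y => MvPolynomial.eval (fun i => y i) (P j)) x) ∧
    (2 ≤ k → ContDiffOn ℝ ((k - 2 : ℕ) : ℕ∞) S Ω)

/-- The spline class `S(n,k,r)` with defect: smoothness `W^r(Ω)` instead of the maximal
smoothness `W^{k-2}(Ω)`. -/
def IsSplineDefect (N₀ : ℕ) (c₀ β : ℝ) (n k r : ℕ) (Ω : Set Plane) (S : Plane → ℝ) : Prop :=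
  ∃ (R : Fin n → Set Plane) (P : Fin n → MvPolynomial (Fin 2) ℝ),
    (∀ j, IsRing N₀ c₀ β (R j)) ∧
    (∀ i j, i ≠ j → interior (R i) ∩ interior (R j) = ∅) ∧
    ((⋃ j, R j) = Ω ∨ (Ω = Set.univ ∧ IsRing N₀ c₀ β (⋃ j, R j))) ∧
    (∀ j, (P j).totalDegree < k) ∧
    (S = fun x => ∑ j, (R j).indicator (fun y => MvPolynomial.eval (fun i => y i) (P j)) x) ∧
    ContDiffOn ℝ ((r : ℕ) : ℕ∞) S Ω

/-- The `L^p(Ω)` quasi-norm, `0 < p < ∞`. -/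
def lpNormE (p : ℝ) (Ω : Set Plane) (f : Plane → ℝ) : ℝ≥0∞ :=
  eLpNorm f (ENNReal.ofReal p) (volume.restrict Ω)

/-- `k`-th finite difference `Δ_h^k f(x)`, set to `0` unless the segment `[x, x+kh] ⊆ Ω`. -/
def deltah (Ω : Set Plane) (k : ℕ) (h : Plane) (f : Plane → ℝ) (x : Plane) : ℝ :=
  if segment ℝ x (x + (k : ℝ) • h) ⊆ Ω then
    ∑ ν ∈ Finset.range (k + 1), (-1 : ℝ) ^ (k + ν) * (k.choose ν : ℝ) * f (x + (ν : ℝ) • h)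
  else 0

/-- Modulus of smoothness `ω_k(f,t)_τ = sup_{|h| ≤ t} ‖Δ_h^k f‖_{L^τ(Ω)}`. -/
def modulus (Ω : Set Plane) (k : ℕ) (τ : ℝ) (f : Plane → ℝ) (t : ℝ) : ℝ≥0∞ :=
  ⨆ (h : Plane) (_ : ‖h‖ ≤ t), lpNormE τ Ω (deltah Ω k h f)

/-- Besov seminorm `|f|_{B^{s,k}_τ} = (∫₀^∞ [t^{-s} ω_k(f,t)_τ]^τ dt/t)^{1/τ}`. -/
def besovSeminorm (Ω : Set Plane) (k : ℕ) (s τ : ℝ) (f : Plane → ℝ) : ℝ≥0∞ :=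
  (∫⁻ t in Set.Ioi (0 : ℝ),
      (ENNReal.ofReal (t ^ (-s)) * modulus Ω k τ f t) ^ τ / ENNReal.ofReal t) ^ (1 / τ)

/-- Error of best `L^p(Ω)`-approximation `S_n^k(f)_p` from the spline class `S(n,k)`. -/
def splineApprox (N₀ : ℕ) (c₀ β : ℝ) (n k : ℕ) (p : ℝ) (Ω : Set Plane) (f : Plane → ℝ) :
    ℝ≥0∞ :=
  ⨅ (S : Plane → ℝ) (_ : IsSpline N₀ c₀ β n k Ω S), lpNormE p Ω fun x => f x - S x

/-- The K-functional `K(f,t; L^p(Ω), B^{s,k}_τ)`. -/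
def kFunctional (Ω : Set Plane) (k : ℕ) (s τ p : ℝ) (f : Plane → ℝ) (t : ℝ) : ℝ≥0∞ :=
  ⨅ g : Plane → ℝ,
    lpNormE p Ω (fun x => f x - g x) + ENNReal.ofReal t * besovSeminorm Ω k s τ g

/-- BV seminorm: the total mass of the distributional gradient of `g` on `Ω`, defined by
duality against compactly supported `C¹` vector fields of norm at most one. -/
def bvSeminorm (Ω : Set Plane) (g : Plane → ℝ) : ℝ≥0∞ :=
  ⨆ (φ : Plane → Plane) (_ : ContDiff ℝ 1 φ ∧ HasCompactSupport φ ∧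
      tsupport φ ⊆ interior Ω ∧ ∀ x, ‖φ x‖ ≤ 1),
    ENNReal.ofReal (∫ x in Ω, g x * ∑ i, fderiv ℝ φ x (EuclideanSpace.single i 1) i)

/-- The K-functional `K(f,t; L²(Ω), BV(Ω))`. -/
def kFunctionalBV (Ω : Set Plane) (f : Plane → ℝ) (t : ℝ) : ℝ≥0∞ :=
  ⨅ g : Plane → ℝ,
    lpNormE 2 Ω (fun x => f x - g x) + ENNReal.ofReal t * bvSeminorm Ω g

/-- Translated pieces that hit every point at most once integrate to at most one full integral. -/
theorem tsum_setLIntegral_translate_le {ι : Type*} [Countable ι] (v : ι → Plane)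
    (A : ι → Set Plane) (hA : ∀ i, MeasurableSet (A i)) {c φ w : Plane → ℝ≥0∞}
    (hφ : Measurable φ) (hw : Measurable w)
    (huniq : ∀ z i j, z - v i ∈ A i → z - v j ∈ A j → i = j)
    (hcw : ∀ i, ∀ x ∈ A i, c x ≤ w (x + v i)) :
    ∑' i, ∫⁻ x in A i, c x * φ (x + v i) ≤ ∫⁻ z, φ z * w z := by
  have key : ∀ i, ∫⁻ x in A i, c x * φ (x + v i) ≤
      ∫⁻ z, (A i).indicator 1 (z - v i) * (φ z * w z) := by
    intro i
    rw [← lintegral_add_right_eq_self (fun z => (A i).indicator (1 : Plane → ℝ≥0∞) (z - v i) *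
      (φ z * w z)) (v i)]
    rw [← lintegral_indicator (hA i)]
    refine lintegral_mono fun x => ?_
    by_cases hx : x ∈ A i
    · simp only [hx, indicator_of_mem, add_sub_cancel_right, Pi.one_apply, one_mul]
      rw [mul_comm]
      gcongr
      exact hcw i x hx
    · simp [hx]
  calc ∑' i, ∫⁻ x in A i, c x * φ (x + v i)
      ≤ ∑' i, ∫⁻ z, (A i).indicator 1 (z - v i) * (φ z * w z) := ENNReal.tsum_le_tsum key
    _ = ∫⁻ z, ∑' i, (A i).indicator 1 (z - v i) * (φ z * w z) := by
        rw [lintegral_tsum]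
        intro i
        have : Measurable fun z => (A i).indicator (1 : Plane → ℝ≥0∞) (z - v i) :=
          (measurable_one.indicator (hA i)).comp (measurable_id.sub_const _)
        exact (this.mul (hφ.mul hw)).aemeasurable
    _ ≤ ∫⁻ z, φ z * w z := by
        refine lintegral_mono fun z => ?_
        simp only
        rw [ENNReal.tsum_mul_right]
        refine mul_le_of_le_one_left' ?_
        by_cases h : ∃ i, z - v i ∈ A i
        · obtain ⟨i, hi⟩ := h
          rw [tsum_eq_single i]
          · exact indicator_le_self' (fun _ _ => zero_le) _
          · intro j hj
            refine indicator_of_notMem (fun hj' => hj (huniq z j i hj' hi)) _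
        · push Not at h
          simp [h]

/-- Averaging a family of pointwise inequalities over pairwise disjoint discrete windows. -/
theorem setLIntegral_le_of_windows (h : Plane) (hh : h ≠ 0) {a b u w : Plane → ℝ≥0∞}
    (hb : Measurable b) (hu : Measurable u) (hw : Measurable w)
    {J : Set Plane} (hJ : MeasurableSet J) (m : Plane → ℕ)
    (hm : ∀ k : ℕ, MeasurableSet {x | x ∈ J ∧ k ≤ m x})
    (hpt : ∀ x ∈ J, ∀ k ≤ m x, a x ≤ u (x - (k : ℝ) • h) + u (x + h + (k : ℝ) • h) +
      ∑ i ∈ Finset.Icc (-(k : ℤ)) k, b (x + (i : ℝ) • h))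
    (huniq : ∀ x ∈ J, ∀ x' ∈ J, ∀ i i' : ℤ, i.natAbs ≤ m x → i'.natAbs ≤ m x' →
      x + (i : ℝ) • h = x' + (i' : ℝ) • h → x = x')
    (hw1 : ∀ x ∈ J, ∀ k ≤ m x, ((m x : ℝ≥0∞) + 1)⁻¹ ≤ w (x - (k : ℝ) • h))
    (hw2 : ∀ x ∈ J, ∀ k ≤ m x, ((m x : ℝ≥0∞) + 1)⁻¹ ≤ w (x + h + (k : ℝ) • h)) :
    ∫⁻ x in J, a x ≤ (∫⁻ x, b x) + 2 * ∫⁻ x, u x * w x := by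
  set c : Plane → ℝ≥0∞ := fun x => ((m x : ℝ≥0∞) + 1)⁻¹ with hc
  let A : ℕ → Set Plane := fun k => {x | x ∈ J ∧ k ≤ m x}
  have hAJ : ∀ k, A k ⊆ J := fun k x hx => hx.1
  have hpt' : ∀ x ∈ J, a x ≤ (∑' k, (A k).indicator (fun x => c x * u (x - (k : ℝ) • h)) x) +
      (∑' k, (A k).indicator (fun x => c x * u (x + h + (k : ℝ) • h)) x) +
      ∑' i : ℤ, (A i.natAbs).indicator (fun x => 1 * b (x + (i : ℝ) • h)) x := by
    intro x hx
    have h0 : ((m x : ℝ≥0∞) + 1) ≠ 0 := by simp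
    have h1 : ((m x : ℝ≥0∞) + 1) ≠ ∞ := by simp
    set B := ∑' i : ℤ, (A i.natAbs).indicator (fun x => 1 * b (x + (i : ℝ) • h)) x with hB
    have hsumB : ∀ k ≤ m x, ∑ i ∈ Finset.Icc (-(k : ℤ)) k, b (x + (i : ℝ) • h) ≤ B := by
      intro k hk
      refine le_trans (Finset.sum_le_sum (fun i hi => ?_)) (ENNReal.sum_le_tsum _)
      have : x ∈ A i.natAbs := ⟨hx, by rw [Finset.mem_Icc] at hi; omega⟩
      simp [this]
    have hS : ∀ v : ℕ → Plane, ∑ k ∈ Finset.range (m x + 1), c x * u (v k) ≤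
        ∑' k, (A k).indicator (fun x => c x * u (v k)) x := by
      intro v
      refine le_trans (Finset.sum_le_sum (fun i hi => ?_)) (ENNReal.sum_le_tsum _)
      have : x ∈ A i := ⟨hx, by rw [Finset.mem_range] at hi; omega⟩
      simp [this]
    have e : a x = ∑ k ∈ Finset.range (m x + 1), c x * a x := by
      simp only [Finset.sum_const, Finset.card_range, nsmul_eq_mul, hc]
      rw [← mul_assoc, Nat.cast_add, Nat.cast_one, ENNReal.mul_inv_cancel h0 h1, one_mul]
    calc a x = ∑ k ∈ Finset.range (m x + 1), c x * a x := e
      _ ≤ ∑ k ∈ Finset.range (m x + 1), (c x * u (x - (k : ℝ) • h) +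
            c x * u (x + h + (k : ℝ) • h) + c x * B) := by
          refine Finset.sum_le_sum fun k hk => ?_
          have hk' : k ≤ m x := by rw [Finset.mem_range] at hk; omega
          rw [← mul_add, ← mul_add]
          gcongr
          exact (hpt x hx k hk').trans (by gcongr; exact hsumB k hk')
      _ = (∑ k ∈ Finset.range (m x + 1), c x * u (x - (k : ℝ) • h)) +
          (∑ k ∈ Finset.range (m x + 1), c x * u (x + h + (k : ℝ) • h)) + B := by
          rw [Finset.sum_add_distrib, Finset.sum_add_distrib]
          congr 1
          simp only [Finset.sum_const, Finset.card_range, nsmul_eq_mul, hc]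
          rw [← mul_assoc, Nat.cast_add, Nat.cast_one, ENNReal.mul_inv_cancel h0 h1, one_mul]
      _ ≤ _ := by
          gcongr
          · exact hS fun k => x - (k : ℝ) • h
          · exact hS fun k => x + h + (k : ℝ) • h
  have hcm : Measurable fun x => J.indicator c x := by
    have : ∀ k : ℕ, MeasurableSet (J ∩ {x | m x = k}) := by
      intro k
      have : J ∩ {x | m x = k} = A k \ A (k + 1) := by
        ext x; simp only [A, mem_inter_iff, mem_ofPred_eq, mem_sdiff]; constructor
        · rintro ⟨h1, h2⟩; exact ⟨⟨h1, h2.ge⟩, fun h3 => by omega⟩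
        · rintro ⟨⟨h1, h2⟩, h3⟩
          refine ⟨h1, ?_⟩
          by_contra h4
          exact h3 ⟨h1, by omega⟩
      rw [this]
      exact (hm k).diff (hm (k + 1))
    have e : (fun x => J.indicator c x) =
        fun x => ∑' k : ℕ, (J ∩ {x | m x = k}).indicator (fun _ => ((k : ℝ≥0∞) + 1)⁻¹) x := by
      funext x
      by_cases hx : x ∈ J
      · rw [tsum_eq_single (m x)]
        · simp [hx, hc]
        · intro k hk
          refine indicator_of_notMem (fun h' => hk h'.2.symm) _
      · simp [hx]
    rw [e]
    exact Measurable.tsum fun k => measurable_const.indicator (this k)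
  have hcmA : ∀ k, ∀ φ : Plane → ℝ≥0∞, Measurable φ →
      Measurable ((A k).indicator (fun x => c x * φ x)) := by
    intro k φ hφ
    have e : (A k).indicator (fun x => c x * φ x) =
        (A k).indicator (fun x => J.indicator c x * φ x) := by
      funext x
      by_cases hx : x ∈ A k
      · simp [hx, hAJ k hx]
      · simp [hx]
    rw [e]
    exact (hcm.mul hφ).indicator (hm k)
  have m1 : ∀ k : ℕ, Measurable ((A k).indicator (fun x => c x * u (x - (k : ℝ) • h))) :=
    fun k => hcmA k _ (hu.comp (by fun_prop))
  have m2 : ∀ k : ℕ, Measurable ((A k).indicator (fun x => c x * u (x + h + (k : ℝ) • h))) :=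
    fun k => hcmA k _ (hu.comp (by fun_prop))
  have m3 : ∀ i : ℤ, Measurable ((A i.natAbs).indicator (fun x => 1 * b (x + (i : ℝ) • h))) :=
    fun k => ((measurable_const.mul (hb.comp (by fun_prop)))).indicator (hm _)
  have inj : ∀ x ∈ J, ∀ x' ∈ J, ∀ i i' : ℤ, i.natAbs ≤ m x → i'.natAbs ≤ m x' →
      x + (i : ℝ) • h = x' + (i' : ℝ) • h → i = i' := by
    intro x hx x' hx' i i' hi hi' e
    have := huniq x hx x' hx' i i' hi hi' e
    subst this
    have := smul_left_injective ℝ hh (add_left_cancel e)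
    exact_mod_cast this
  have I1 : ∑' k, ∫⁻ x in A k, c x * u (x - (k : ℝ) • h) ≤ ∫⁻ x, u x * w x := by
    have := tsum_setLIntegral_translate_le (fun k : ℕ => -((k : ℝ) • h)) A hm (c := c) hu hw ?_ ?_
    · simpa only [← sub_eq_add_neg] using this
    · intro z i j hi hj
      have := inj _ hi.1 _ hj.1 (-i) (-j) (by simpa using hi.2)
        (by simpa using hj.2) (by push_cast; simp)
      omega
    · intro k x hx
      rw [← sub_eq_add_neg]
      exact hw1 x hx.1 k hx.2
  have I2 : ∑' k, ∫⁻ x in A k, c x * u (x + h + (k : ℝ) • h) ≤ ∫⁻ x, u x * w x := by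
    have := tsum_setLIntegral_translate_le (fun k : ℕ => h + (k : ℝ) • h) A hm (c := c) hu hw ?_ ?_
    · simpa only [← add_assoc] using this
    · intro z i j hi hj
      have := inj _ hi.1 _ hj.1 i j (by simpa using hi.2)
        (by simpa using hj.2) (by push_cast; abel)
      omega
    · intro k x hx
      rw [← add_assoc]
      exact hw2 x hx.1 k hx.2
  have I3 : ∑' i : ℤ, ∫⁻ x in A i.natAbs, 1 * b (x + (i : ℝ) • h) ≤ ∫⁻ x, b x := by
    have := tsum_setLIntegral_translate_le (fun i : ℤ => (i : ℝ) • h) (fun i => A i.natAbs)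
      (fun i => hm _) (c := 1) (w := 1) hb measurable_one ?_ ?_
    · simpa using this
    · intro z i j hi hj
      have hi2 := hi.2
      have hj2 := hj.2
      exact inj _ hi.1 _ hj.1 i j hi2 hj2 (by abel)
    · intro k x hx
      simp
  calc ∫⁻ x in J, a x ≤ ∫⁻ x in J, ((∑' k, (A k).indicator (fun x => c x * u (x - (k : ℝ) • h)) x) +
      (∑' k, (A k).indicator (fun x => c x * u (x + h + (k : ℝ) • h)) x) +
      ∑' i : ℤ, (A i.natAbs).indicator (fun x => 1 * b (x + (i : ℝ) • h)) x) :=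
        setLIntegral_mono' hJ hpt'
    _ ≤ ∫⁻ x, ((∑' k, (A k).indicator (fun x => c x * u (x - (k : ℝ) • h)) x) +
      (∑' k, (A k).indicator (fun x => c x * u (x + h + (k : ℝ) • h)) x) +
      ∑' i : ℤ, (A i.natAbs).indicator (fun x => 1 * b (x + (i : ℝ) • h)) x) :=
        setLIntegral_le_lintegral _ _
    _ = (∑' k, ∫⁻ x in A k, c x * u (x - (k : ℝ) • h)) +
        (∑' k, ∫⁻ x in A k, c x * u (x + h + (k : ℝ) • h)) +
        ∑' i : ℤ, ∫⁻ x in A i.natAbs, 1 * b (x + (i : ℝ) • h) := by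
        rw [lintegral_add_right _ (Measurable.tsum m3),
          lintegral_add_right _ (Measurable.tsum m2),
          lintegral_tsum fun k => (m1 k).aemeasurable,
          lintegral_tsum fun k => (m2 k).aemeasurable,
          lintegral_tsum fun k => (m3 k).aemeasurable]
        simp only [lintegral_indicator (hm _), A]
    _ ≤ (∫⁻ x, u x * w x) + (∫⁻ x, u x * w x) + ∫⁻ x, b x := by gcongr
    _ = _ := by rw [two_mul, add_comm]

theorem eq_add_of_orthogonal_plane {d w : Plane} (hd : d ≠ 0) (hw : w ≠ 0)
    (hdw : inner ℝ d w = 0) (v : Plane) :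
    v = (inner ℝ v d / ‖d‖ ^ 2) • d + (inner ℝ v w / ‖w‖ ^ 2) • w := by
  set u : Plane := v - ((inner ℝ v d / ‖d‖ ^ 2) • d + (inner ℝ v w / ‖w‖ ^ 2) • w) with hu
  have hd' : ‖d‖ ^ 2 ≠ 0 := by simpa using hd
  have hw' : ‖w‖ ^ 2 ≠ 0 := by simpa using hw
  have hwd : inner ℝ w d = 0 := by rw [real_inner_comm]; exact hdw
  have h1 : inner ℝ u d = 0 := by
    rw [hu, inner_sub_left, inner_add_left, inner_smul_left, inner_smul_left, hwd,
      real_inner_self_eq_norm_sq]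
    simp only [conj_trivial]
    field_simp
    ring
  have h2 : inner ℝ u w = 0 := by
    rw [hu, inner_sub_left, inner_add_left, inner_smul_left, inner_smul_left, hdw,
      real_inner_self_eq_norm_sq]
    simp only [conj_trivial]
    field_simp
    ring
  have e1 : ‖d‖ ^ 2 = d 0 ^ 2 + d 1 ^ 2 := by simp [EuclideanSpace.norm_sq_eq]
  have e2 : ‖w‖ ^ 2 = w 0 ^ 2 + w 1 ^ 2 := by simp [EuclideanSpace.norm_sq_eq]
  rw [e1] at hd'
  rw [e2] at hw'
  simp only [PiLp.inner_apply, Fin.sum_univ_two, RCLike.inner_apply, conj_trivial] at h1 h2 hdw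
  have hdet : (d 0 * w 1 - d 1 * w 0) ≠ 0 := by
    intro h0
    have : (d 0 ^ 2 + d 1 ^ 2) * (w 0 ^ 2 + w 1 ^ 2) = 0 := by
      linear_combination (d 0 * w 1 - d 1 * w 0) * h0 + (w 0 * d 0 + w 1 * d 1) * hdw
    rcases mul_eq_zero.1 this with h | h
    · exact hd' h
    · exact hw' h
  have u0 : u 0 = 0 := by
    have : u 0 * (d 0 * w 1 - d 1 * w 0) = 0 := by linear_combination w 1 * h1 - d 1 * h2
    exact (mul_eq_zero.1 this).resolve_right hdet
  have u1 : u 1 = 0 := by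
    have : u 1 * (d 0 * w 1 - d 1 * w 0) = 0 := by linear_combination d 0 * h2 - w 0 * h1
    exact (mul_eq_zero.1 this).resolve_right hdet
  have : u = 0 := by
    ext i
    fin_cases i
    · simpa using u0
    · simpa using u1
  exact sub_eq_zero.1 this

/-- The half discs of relative radius `κ` on one fixed side of `[a, b]` lie in `R`. -/
def HasHalfDiscs (κ : ℝ) (R : Set Plane) (a b : Plane) : Prop :=
  a ≠ b ∧ ∃ n : Plane, ‖n‖ = 1 ∧ inner ℝ (b - a) n = 0 ∧
    ∀ y ∈ segment ℝ a b, ∀ r, r ≤ dist y a → r ≤ dist y b →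
      ∀ z, dist z y ≤ κ * r → 0 ≤ inner ℝ (z - y) n → z ∈ R

theorem HasGoodTriangle.ne {β : ℝ} {R : Set Plane} {a b : Plane} (h : HasGoodTriangle β R a b)
    (hβ' : β ≤ Real.pi / 3) : a ≠ b := by
  rintro rfl
  obtain ⟨c, -, h1, -⟩ := h
  rw [EuclideanGeometry.angle_self_left] at h1
  linarith [Real.pi_pos]

theorem Convex.triple_mem {K : Set Plane} (hK : Convex ℝ K) {a b c : Plane} (ha : a ∈ K)
    (hb : b ∈ K) (hc : c ∈ K) {x y z : ℝ} (hx : 0 ≤ x) (hy : 0 ≤ y) (hz : 0 ≤ z)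
    (h1 : x + y + z = 1) : x • a + y • b + z • c ∈ K := by
  have := hK.sum_mem (t := Finset.univ) (w := ![x, y, z]) (z := ![a, b, c])
    (by intro i _; fin_cases i <;> simpa) (by simpa [Fin.sum_univ_three] using h1)
    (by intro i _; fin_cases i <;> simpa)
  simpa [Fin.sum_univ_three] using this

theorem HasGoodTriangle.exists_apex {β : ℝ} {R : Set Plane} {a b : Plane}
    (h : HasGoodTriangle β R a b) (hβ : 0 < β) (hβ' : β ≤ Real.pi / 3) :
    ∃ w : Plane, inner ℝ (b - a) w = 0 ∧ ‖w‖ = Real.tan β * ‖b - a‖ / 2 ∧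
      convexHull ℝ {a, b, a + ((1 / 2 : ℝ) • (b - a) + w)} ⊆ R := by
  have hab := h.ne hβ'
  obtain ⟨c, hR, h1, h2⟩ := h
  have hpi := Real.pi_pos
  have hcos : 0 < Real.cos β := Real.cos_pos_of_mem_Ioo ⟨by linarith, by linarith⟩
  have hsin : 0 < Real.sin β := Real.sin_pos_of_pos_of_lt_pi hβ (by linarith)
  have htan : 0 < Real.tan β := Real.tan_pos_of_pos_of_lt_pi_div_two hβ (by linarith)
  have hsc := Real.sin_sq_add_cos_sq β
  obtain ⟨d, rfl⟩ : ∃ d, b = a + d := ⟨b - a, by abel⟩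
  obtain ⟨w, rfl⟩ : ∃ w, c = a + ((1 / 2 : ℝ) • d + w) := ⟨c - a - (1 / 2 : ℝ) • d, by abel⟩
  have hd : d ≠ 0 := by rintro rfl; simp at hab
  have hD : 0 < ‖d‖ := norm_pos_iff.2 hd
  set e : Plane := (1 / 2 : ℝ) • d + w with he
  have c1 : inner ℝ d e = Real.cos β * (‖d‖ * ‖e‖) := by
    have := InnerProductGeometry.cos_angle_mul_norm_mul_norm d e
    rw [← this, ← h1]
    simp [EuclideanGeometry.angle]
  have c2 : ‖d‖ ^ 2 - inner ℝ d e = Real.cos β * (‖d‖ * ‖e - d‖) := by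
    have := InnerProductGeometry.cos_angle_mul_norm_mul_norm (-d) (e - d)
    have h3 : EuclideanGeometry.angle a (a + d) (a + e) =
        InnerProductGeometry.angle (-d) (e - d) := by
      simp [EuclideanGeometry.angle]
    rw [← h3, h2, norm_neg, inner_neg_left, inner_sub_right, real_inner_self_eq_norm_sq] at this
    linarith
  have c3 : ‖e - d‖ ^ 2 = ‖e‖ ^ 2 - 2 * inner ℝ d e + ‖d‖ ^ 2 := by
    rw [norm_sub_sq_real, real_inner_comm]
  have hP : inner ℝ d e = ‖d‖ ^ 2 / 2 := by
    have q1 : (inner ℝ d e) ^ 2 = Real.cos β ^ 2 * (‖d‖ ^ 2 * ‖e‖ ^ 2) := by rw [c1]; ring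
    have q2 : (‖d‖ ^ 2 - inner ℝ d e) ^ 2 = Real.cos β ^ 2 * (‖d‖ ^ 2 * ‖e - d‖ ^ 2) := by
      rw [c2]; ring
    rw [c3] at q2
    have : Real.sin β ^ 2 * ‖d‖ ^ 2 * (‖d‖ ^ 2 - 2 * inner ℝ d e) = 0 := by
      linear_combination q2 - q1 + ‖d‖ ^ 2 * (‖d‖ ^ 2 - 2 * inner ℝ d e) * hsc
    have h0 : Real.sin β ^ 2 * ‖d‖ ^ 2 ≠ 0 := by positivity
    linarith [(mul_eq_zero.1 this).resolve_left h0]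
  have hdw : inner ℝ d w = 0 := by
    rw [he, inner_add_right, inner_smul_right, real_inner_self_eq_norm_sq] at hP
    linarith
  have hw2 : ‖w‖ = Real.tan β * ‖d‖ / 2 := by
    have q0 : ‖e‖ ^ 2 = ‖d‖ ^ 2 / 4 + ‖w‖ ^ 2 := by
      rw [he, norm_add_sq_real, inner_smul_left, hdw, norm_smul]
      norm_num
      ring
    have q1 : ‖d‖ ^ 2 / 2 = Real.cos β * (‖d‖ * ‖e‖) := by rw [← hP, c1]
    have q2 : ‖d‖ / 2 = Real.cos β * ‖e‖ := by
      have : ‖d‖ * (‖d‖ / 2) = ‖d‖ * (Real.cos β * ‖e‖) := by linarith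
      exact mul_left_cancel₀ hD.ne' this
    have q3 : ‖d‖ ^ 2 / 4 = Real.cos β ^ 2 * (‖d‖ ^ 2 / 4 + ‖w‖ ^ 2) := by
      rw [← q0]; calc ‖d‖ ^ 2 / 4 = (‖d‖ / 2) ^ 2 := by ring
        _ = _ := by rw [q2]; ring
    have q4 : (Real.cos β * ‖w‖) ^ 2 = (Real.sin β * ‖d‖ / 2) ^ 2 := by
      linear_combination -q3 + ‖d‖ ^ 2 / 4 * hsc * (-1)
    have q5 : Real.cos β * ‖w‖ = Real.sin β * ‖d‖ / 2 :=
      (sq_eq_sq₀ (by positivity) (by positivity)).1 q4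
    rw [Real.tan_eq_sin_div_cos]
    field_simp
    linarith
  rw [add_sub_cancel_left]
  exact ⟨w, hdw, hw2, hR⟩

theorem HasGoodTriangle.hasHalfDiscs {β : ℝ} {R : Set Plane} {a b : Plane}
    (h : HasGoodTriangle β R a b) (hβ : 0 < β) (hβ' : β ≤ Real.pi / 3) :
    HasHalfDiscs (Real.tan β / (1 + Real.tan β)) R a b := by
  have hab := h.ne hβ'
  obtain ⟨w, hdw, hw2, hR⟩ := h.exists_apex hβ hβ'
  have htan : 0 < Real.tan β :=
    Real.tan_pos_of_pos_of_lt_pi_div_two hβ (by linarith [Real.pi_pos])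
  obtain ⟨d, rfl⟩ : ∃ d, b = a + d := ⟨b - a, by abel⟩
  rw [add_sub_cancel_left] at hdw hw2 hR
  have hd : d ≠ 0 := by rintro rfl; simp at hab
  have hD : 0 < ‖d‖ := norm_pos_iff.2 hd
  have hW : 0 < ‖w‖ := by rw [hw2]; positivity
  have hw : w ≠ 0 := norm_pos_iff.1 hW
  refine ⟨hab, (‖w‖⁻¹ : ℝ) • w, by rw [norm_smul]; simp [hW.ne'], ?_, ?_⟩
  · rw [add_sub_cancel_left, inner_smul_right, hdw, mul_zero]
  intro y hy r hra hrb z hz hzn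
  rw [segment_eq_image'] at hy
  obtain ⟨t, ⟨ht0, ht1⟩, rfl⟩ := hy
  simp only [add_sub_cancel_left] at *
  have hra' : r ≤ t * ‖d‖ := by
    simpa [dist_eq_norm, norm_smul, abs_of_nonneg ht0] using hra
  have hrb' : r ≤ (1 - t) * ‖d‖ := by
    have : a + t • d - (a + d) = -((1 - t) • d) := by module
    rw [dist_eq_norm, this, norm_neg, norm_smul, Real.norm_eq_abs,
      abs_of_nonneg (by linarith)] at hrb
    exact hrb
  obtain ⟨v, rfl⟩ : ∃ v, z = a + t • d + v := ⟨z - (a + t • d), by abel⟩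
  simp only [add_sub_cancel_left, inner_smul_right] at hzn
  have hv : ‖v‖ ≤ Real.tan β / (1 + Real.tan β) * r := by simpa [dist_eq_norm] using hz
  have hvw : 0 ≤ inner ℝ v w := by
    by_contra h'
    push Not at h'
    have := mul_neg_of_pos_of_neg (inv_pos.2 hW) h'
    linarith
  set α : ℝ := inner ℝ v d / ‖d‖ ^ 2 with hα
  set γ : ℝ := inner ℝ v w / ‖w‖ ^ 2 with hγ
  have hdec : v = α • d + γ • w := eq_add_of_orthogonal_plane hd hw hdw v
  have hγ0 : 0 ≤ γ := by positivity
  have bα : |α| * ‖d‖ ≤ ‖v‖ := by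
    rw [hα, abs_div, abs_of_nonneg (by positivity : (0 : ℝ) ≤ ‖d‖ ^ 2)]
    have := abs_real_inner_le_norm v d
    rw [div_mul_eq_mul_div, div_le_iff₀ (by positivity)]
    nlinarith
  have bγ : γ * ‖w‖ ≤ ‖v‖ := by
    rw [hγ, div_mul_eq_mul_div, div_le_iff₀ (by positivity)]
    have := real_inner_le_norm v w
    nlinarith
  rw [hw2] at bγ
  have bγ' : γ / 2 * ‖d‖ ≤ ‖v‖ / Real.tan β := by
    rw [le_div_iff₀ htan]; linarith
  have bsum : ‖v‖ + ‖v‖ / Real.tan β ≤ r := by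
    have : ‖v‖ + ‖v‖ / Real.tan β = ‖v‖ * ((1 + Real.tan β) / Real.tan β) := by
      field_simp
      ring
    rw [this]
    calc ‖v‖ * ((1 + Real.tan β) / Real.tan β)
        ≤ Real.tan β / (1 + Real.tan β) * r * ((1 + Real.tan β) / Real.tan β) := by gcongr
      _ = r := by field_simp
  have k1 : γ / 2 ≤ t + α := by
    have : (γ / 2) * ‖d‖ ≤ (t + α) * ‖d‖ := by
      have := neg_abs_le α
      nlinarith
    exact le_of_mul_le_mul_right this hD
  have k2 : γ / 2 ≤ 1 - t - α := by
    have : (γ / 2) * ‖d‖ ≤ (1 - t - α) * ‖d‖ := by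
      have := le_abs_self α
      nlinarith
    exact le_of_mul_le_mul_right this hD
  have hz' : a + t • d + v = (1 - (t + α) - γ / 2) • a + (t + α - γ / 2) • (a + d) +
      γ • (a + ((1 / 2 : ℝ) • d + w)) := by
    rw [hdec]
    module
  rw [hz']
  exact hR ((convex_convexHull ℝ _).triple_mem (subset_convexHull ℝ _ (by simp))
    (subset_convexHull ℝ _ (by simp)) (subset_convexHull ℝ _ (by simp)) (by linarith)
    (by linarith) hγ0 (by ring))

theorem exists_union_segment_eq {a b c d x y : Plane} (hxy : x ≠ y) (hx : x ∈ segment ℝ a b)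
    (hy : y ∈ segment ℝ a b) (hx' : x ∈ segment ℝ c d) (hy' : y ∈ segment ℝ c d) :
    ∃ p q, segment ℝ a b ∪ segment ℝ c d = segment ℝ p q := by
  have key : ∀ a b : Plane, x ∈ segment ℝ a b → y ∈ segment ℝ a b →
      ∃ α β : ℝ, α ≤ 0 ∧ 0 ≤ β ∧ segment ℝ a b = AffineMap.lineMap x y '' Icc α β := by
    intro a b hx hy
    have aux : ∀ s t : ℝ, 0 ≤ s → s ≤ 1 → s < t → ∀ a b : Plane,
        x = a + s • (b - a) → y = a + t • (b - a) →
        ∃ α β : ℝ, α ≤ 0 ∧ 0 ≤ β ∧ segment ℝ a b = AffineMap.lineMap x y '' Icc α β := by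
      intro s t hs hs1 hst a b hx hy
      have hst' : 0 < t - s := by linarith
      refine ⟨-s / (t - s), (1 - s) / (t - s), ?_, ?_, ?_⟩
      · exact div_nonpos_of_nonpos_of_nonneg (by linarith) hst'.le
      · exact div_nonneg (by linarith) hst'.le
      · rw [← segment_eq_Icc (by gcongr; linarith), image_segment]
        have e : y - x = (t - s) • (b - a) := by rw [hx, hy]; module
        congr 1
        · rw [AffineMap.lineMap_apply, vsub_eq_sub, e, smul_smul, div_mul_cancel₀ _ hst'.ne', hx]
          simp
        · rw [AffineMap.lineMap_apply, vsub_eq_sub, e, smul_smul, div_mul_cancel₀ _ hst'.ne', hx]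
          rw [vadd_eq_add]; module
    rw [segment_eq_image'] at hx hy
    obtain ⟨s, ⟨hs0, hs1⟩, hs⟩ := hx
    obtain ⟨t, ⟨ht0, ht1⟩, ht⟩ := hy
    simp only at hs ht
    rcases lt_trichotomy s t with h | h | h
    · exact aux s t hs0 hs1 h a b hs.symm ht.symm
    · exact absurd (by rw [← hs, ← ht, h]) hxy
    · rw [segment_symm]
      refine aux (1 - s) (1 - t) (by linarith) (by linarith) (by linarith) b a ?_ ?_
      · rw [← hs]; module
      · rw [← ht]; module
  obtain ⟨α, β, hα, hβ, e⟩ := key a b hx hy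
  obtain ⟨α', β', hα', hβ', e'⟩ := key c d hx' hy'
  refine ⟨AffineMap.lineMap x y (min α α'), AffineMap.lineMap x y (max β β'), ?_⟩
  have hle : min α α' ≤ max β β' := (min_le_left _ _).trans (hα.trans (hβ.trans (le_max_left _ _)))
  rw [e, e', ← image_union, ← image_segment, segment_eq_Icc hle, Icc_union_Icc'
    (by linarith) (by linarith)]

theorem segment_infinite {a b : Plane} (h : a ≠ b) : (segment ℝ a b).Infinite := by
  rw [segment_eq_image_lineMap]
  exact (Icc_infinite one_pos).image (AffineMap.lineMap_injective ℝ h).injOn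

/-- Maximal segments covering a set that is a union of few segments may be chosen few. -/
theorem exists_few_maximal_segments {F : Set Plane} {m : ℕ} (v w : Fin m → Plane)
    (J : Finset (Plane × Plane)) (hF : F = ⋃ i, segment ℝ (v i) (w i))
    (hJ : F = ⋃ e ∈ J, segment ℝ e.1 e.2)
    (hmax : ∀ i, ∀ a b : Plane, segment ℝ (v i) (w i) ⊆ segment ℝ a b →
        segment ℝ a b ⊆ F → segment ℝ a b = segment ℝ (v i) (w i))
    (hne : ∀ i, v i ≠ w i) :
    ∃ I : Finset (Fin m), I.card ≤ J.card ∧ F = ⋃ i ∈ I, segment ℝ (v i) (w i) := by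
  have h1 : ∀ i, ∃ e ∈ J, ∃ x y, x ≠ y ∧ x ∈ segment ℝ (v i) (w i) ∧ y ∈ segment ℝ (v i) (w i) ∧
      x ∈ segment ℝ e.1 e.2 ∧ y ∈ segment ℝ e.1 e.2 := by
    intro i
    by_contra hcon
    push Not at hcon
    have hfin : (⋃ e ∈ J, (segment ℝ (v i) (w i) ∩ segment ℝ e.1 e.2)).Finite := by
      refine Set.Finite.biUnion J.finite_toSet fun e he => Set.Subsingleton.finite ?_
      intro x hx y hy
      by_contra hxy
      exact hcon e he x y hxy hx.1 hy.1 hx.2 hy.2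
    refine segment_infinite (hne i) (hfin.subset ?_)
    rw [← inter_iUnion₂, ← hJ, hF]
    exact subset_inter subset_rfl (subset_iUnion (fun i => segment ℝ (v i) (w i)) i)
  choose j hjJ x y hxy hx hy hx' hy' using h1
  have hsub : ∀ i, segment ℝ (j i).1 (j i).2 ⊆ segment ℝ (v i) (w i) := by
    intro i
    obtain ⟨p, q, hpq⟩ := exists_union_segment_eq (hxy i) (hx i) (hy i) (hx' i) (hy' i)
    rw [← hmax i p q (by rw [← hpq]; exact subset_union_left) ?_, ← hpq]
    · exact subset_union_right
    · rw [← hpq]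
      refine union_subset ?_ ?_
      · rw [hF]; exact subset_iUnion (fun i => segment ℝ (v i) (w i)) i
      · rw [hJ]; exact subset_biUnion_of_mem (u := fun e : Plane × Plane => segment ℝ e.1 e.2)
          (hjJ i)
  have heq : ∀ i i', j i = j i' → segment ℝ (v i) (w i) = segment ℝ (v i') (w i') := by
    intro i i' h
    have a1 : x i ∈ segment ℝ (v i') (w i') := hsub i' (h ▸ hx' i)
    have a2 : y i ∈ segment ℝ (v i') (w i') := hsub i' (h ▸ hy' i)
    obtain ⟨p, q, hpq⟩ := exists_union_segment_eq (hxy i) (hx i) (hy i) a1 a2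
    have hpF : segment ℝ p q ⊆ F := by
      rw [← hpq, hF]
      exact union_subset (subset_iUnion (fun i => segment ℝ (v i) (w i)) i)
        (subset_iUnion (fun i => segment ℝ (v i) (w i)) i')
    rw [← hmax i p q (by rw [← hpq]; exact subset_union_left) hpF,
      ← hmax i' p q (by rw [← hpq]; exact subset_union_right) hpF]
  obtain ⟨I, -, hI, hIimg⟩ := Finset.exists_subset_injOn_image_eq_of_surjOn (f := j)
    Set.univ (Finset.univ.image j) (by intro e he; simpa using he)
  refine ⟨I, ?_, ?_⟩
  · rw [← Finset.card_image_of_injOn hI]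
    refine Finset.card_le_card fun e he => ?_
    obtain ⟨i, -, rfl⟩ := Finset.mem_image.1 he
    exact hjJ i
  · apply Subset.antisymm
    · conv_lhs => rw [hF]
      refine iUnion_subset fun i => ?_
      have : j i ∈ I.image j := by rw [hIimg]; exact Finset.mem_image_of_mem _ (Finset.mem_univ i)
      obtain ⟨i', hi', hii⟩ := Finset.mem_image.1 this
      rw [heq i i' hii.symm]
      exact subset_biUnion_of_mem (u := fun i => segment ℝ (v i) (w i)) (Finset.mem_coe.2 hi')
    · conv_rhs => rw [hF]
      exact iUnion₂_subset fun i _ => subset_iUnion (fun i => segment ℝ (v i) (w i)) i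

/-- A closed set whose boundary is a null set made of at most `K` edges, each of which carries
half discs inside the set. -/
structure HasEdges (κ : ℝ) (K : ℕ) (R : Set Plane) : Prop where
  isClosed : IsClosed R
  null_frontier : volume (frontier R) = 0
  exists_edges : ∃ E : Finset (Plane × Plane), E.card ≤ K ∧
    frontier R = (⋃ e ∈ E, segment ℝ e.1 e.2) ∧ ∀ e ∈ E, HasHalfDiscs κ R e.1 e.2

theorem IsRing.frontier_eq {N₀ : ℕ} {c₀ β : ℝ} {R : Set Plane} (hR : IsRing N₀ c₀ β R) :
    IsClosed R ∧ volume (frontier R) = 0 ∧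
      ∃ J : Finset (Plane × Plane), J.card ≤ 2 * N₀ ∧
        frontier R = ⋃ e ∈ J, segment ℝ e.1 e.2 := by
  obtain ⟨⟨Q₁, Q₂, hQ₁, hQ₂, rfl⟩, -⟩ := hR
  have hpoly : ∀ Q, IsRegularConvexPolygon N₀ c₀ Q → ∃ J : Finset (Plane × Plane), J.card ≤ N₀ ∧
        frontier Q = ⋃ e ∈ J, segment ℝ e.1 e.2 := by
    rintro Q ⟨-, -, -, ⟨m, v, w, hm, hfr⟩, -⟩
    refine ⟨Finset.univ.image fun i => (v i, w i), Finset.card_image_le.trans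
      (by simpa using hm), ?_⟩
    rw [hfr]
    ext x
    simp
  have hcl : IsClosed (Q₁ \ interior Q₂) := hQ₁.1.isClosed.sdiff isOpen_interior
  have hint : interior Q₂ ⊆ interior Q₁ := by
    rcases hQ₂ with rfl | ⟨h, -⟩
    · simp
    · exact interior_mono h
  have hfr₂ : IsClosed Q₂ := by
    rcases hQ₂ with rfl | ⟨h, h'⟩
    · exact isClosed_empty
    · exact h'.1.isClosed
  have hsub : frontier (Q₁ \ interior Q₂) ⊆ frontier Q₁ ∪ frontier Q₂ := by
    rw [Set.sdiff_eq]
    refine (frontier_inter_subset _ _).trans (union_subset_union inter_subset_left ?_)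
    rw [frontier_compl]
    exact inter_subset_right.trans frontier_interior_subset
  have hsup : frontier Q₁ ∪ frontier Q₂ ⊆ frontier (Q₁ \ interior Q₂) := by
    rw [hcl.frontier_eq, hQ₁.1.isClosed.frontier_eq, hfr₂.frontier_eq]
    refine union_subset ?_ ?_
    · rintro x ⟨hx, hx'⟩
      exact ⟨⟨hx, fun h => hx' (hint h)⟩, fun h => hx' (interior_mono sdiff_subset h)⟩
    · rintro x ⟨hx, hx'⟩
      rcases hQ₂ with rfl | ⟨h12, h2⟩
      · simp at hx
      obtain ⟨-, hconv, -, -, x₁, x₂, r₁, r₂, hr, hball, -⟩ := h2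
      refine ⟨⟨h12 hx, hx'⟩, fun h => ?_⟩
      have hne : (interior Q₂).Nonempty :=
        ⟨x₂, interior_mono hball (by rw [interior_closedBall _ hr.ne']; exact mem_ball_self hr)⟩
      have hxc : x ∈ closure (interior Q₂) := by
        rw [hconv.closure_interior_eq_closure_of_nonempty_interior hne]
        exact subset_closure hx
      obtain ⟨z, hz1, hz2⟩ := mem_closure_iff.1 hxc _ isOpen_interior h
      exact (interior_subset hz1).2 hz2
  have heq := hsub.antisymm hsup
  refine ⟨hcl, ?_, ?_⟩
  · rw [heq]
    refine measure_union_null (hQ₁.2.1.addHaar_frontier _) ?_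
    rcases hQ₂ with rfl | ⟨h, h'⟩
    · simp
    · exact h'.2.1.addHaar_frontier _
  · obtain ⟨J₁, hJ₁, e₁⟩ := hpoly Q₁ hQ₁
    obtain ⟨J₂, hJ₂, e₂⟩ : ∃ J : Finset (Plane × Plane), J.card ≤ N₀ ∧
        frontier Q₂ = ⋃ e ∈ J, segment ℝ e.1 e.2 := by
      rcases hQ₂ with rfl | ⟨h, h'⟩
      · exact ⟨∅, by simp, by simp⟩
      · exact hpoly Q₂ h'
    refine ⟨J₁ ∪ J₂, (Finset.card_union_le _ _).trans (by omega), ?_⟩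
    rw [heq, e₁, e₂, ← Finset.set_biUnion_union]

theorem segment_eq_union_of_mem {a b p : Plane} (hp : p ∈ segment ℝ a b) :
    segment ℝ a b = segment ℝ a p ∪ segment ℝ p b := by
  apply Subset.antisymm
  · rw [segment_eq_image_lineMap] at hp
    obtain ⟨t, ht, rfl⟩ := hp
    intro z hz
    rw [segment_eq_image_lineMap] at hz
    obtain ⟨u, hu, rfl⟩ := hz
    rcases le_total u t with h | h
    · left
      have := mem_image_of_mem (AffineMap.lineMap a b : ℝ →ᵃ[ℝ] Plane)
        (show u ∈ Icc 0 t from ⟨hu.1, h⟩)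
      rwa [← segment_eq_Icc ht.1, image_segment, AffineMap.lineMap_apply_zero] at this
    · right
      have := mem_image_of_mem (AffineMap.lineMap a b : ℝ →ᵃ[ℝ] Plane)
        (show u ∈ Icc t 1 from ⟨h, hu.2⟩)
      rwa [← segment_eq_Icc ht.2, image_segment, AffineMap.lineMap_apply_one] at this
  · refine union_subset ?_ ?_
    · exact (convex_segment _ _).segment_subset (left_mem_segment _ _ _) hp
    · exact (convex_segment _ _).segment_subset hp (right_mem_segment _ _ _)

theorem IsRing.hasEdges {N₀ : ℕ} {c₀ β : ℝ} {R : Set Plane} (hR : IsRing N₀ c₀ β R)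
    (hβ : 0 < β) (hβ' : β ≤ Real.pi / 3) :
    HasEdges (Real.tan β / (1 + Real.tan β)) (4 * N₀) R := by
  obtain ⟨hcl, hnull, J, hJ, hfr⟩ := hR.frontier_eq
  refine ⟨hcl, hnull, ?_⟩
  obtain ⟨-, m, v, w, hF, hmax, htri⟩ := hR
  choose p hp h1 h2 using htri
  have hne : ∀ i, v i ≠ w i := by
    intro i h
    have := hp i
    rw [← h, segment_same] at this
    exact (h1 i).ne hβ' this.symm
  obtain ⟨I, hI, hFI⟩ := exists_few_maximal_segments v w J hF hfr hmax hne
  refine ⟨(I.image fun i => (v i, p i)) ∪ (I.image fun i => (p i, w i)), ?_, ?_, ?_⟩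
  · have a1 := Finset.card_union_le (I.image fun i => (v i, p i)) (I.image fun i => (p i, w i))
    have a2 := Finset.card_image_le (s := I) (f := fun i => (v i, p i))
    have a3 := Finset.card_image_le (s := I) (f := fun i => (p i, w i))
    omega
  · have hsplit := fun i => segment_eq_union_of_mem (hp i)
    rw [hFI, Finset.set_biUnion_union]
    simp only [hsplit, Finset.set_biUnion_finset_image, iUnion_union_distrib]
  · intro e he
    rcases Finset.mem_union.1 he with h | h
    · obtain ⟨i, -, rfl⟩ := Finset.mem_image.1 h
      exact (h1 i).hasHalfDiscs hβ hβ'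
    · obtain ⟨i, -, rfl⟩ := Finset.mem_image.1 h
      exact (h2 i).hasHalfDiscs hβ hβ'

/-- Each edge has a ball of comparable size inside the set, close to any given point of it. -/
theorem HasHalfDiscs.exists_ball {κ : ℝ} (hκ : 0 < κ) (hκ1 : κ ≤ 1) {R : Set Plane} {a b y : Plane}
    (h : HasHalfDiscs κ R a b) (hy : y ∈ segment ℝ a b) {ℓ : ℝ} (hℓ : 0 < ℓ)
    (hℓ' : ℓ ≤ dist a b) : ∃ z, dist z y ≤ ℓ ∧ ball z (κ * ℓ / 4) ⊆ R := by
  obtain ⟨hab, n, hn, hdn, H⟩ := h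
  obtain ⟨d, rfl⟩ : ∃ d, b = a + d := ⟨b - a, by abel⟩
  have hd : d ≠ 0 := by rintro rfl; simp at hab
  have hD : 0 < ‖d‖ := norm_pos_iff.2 hd
  have hℓD : ℓ ≤ ‖d‖ := by simpa [dist_eq_norm] using hℓ'
  rw [segment_eq_image'] at hy
  obtain ⟨t, ⟨ht0, ht1⟩, rfl⟩ := hy
  simp only [add_sub_cancel_left] at *
  set s : ℝ := ℓ / ‖d‖ with hs
  have hs0 : 0 < s := by positivity
  have hs1 : s ≤ 1 := by rw [hs, div_le_one hD]; exact hℓD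
  have hsD : s * ‖d‖ = ℓ := by rw [hs]; field_simp
  set q : ℝ := (1 - s) * t + s / 2 with hq
  have hq1 : s / 2 ≤ q := by nlinarith [mul_nonneg (sub_nonneg.2 hs1) ht0]
  have hq2 : s / 2 ≤ 1 - q := by nlinarith [mul_nonneg (sub_nonneg.2 hs1) (sub_nonneg.2 ht1)]
  have hqt : |q - t| ≤ s / 2 := by
    have : q - t = s * (1 / 2 - t) := by rw [hq]; ring
    rw [this, abs_mul, abs_of_pos hs0]
    have : |1 / 2 - t| ≤ 1 / 2 := by rw [abs_le]; constructor <;> linarith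
    nlinarith
  refine ⟨a + q • d + (κ * ℓ / 4) • n, ?_, ?_⟩
  · have e : a + q • d + (κ * ℓ / 4) • n - (a + t • d) = (q - t) • d + (κ * ℓ / 4) • n := by module
    rw [dist_eq_norm, e]
    refine (norm_add_le _ _).trans ?_
    rw [norm_smul, norm_smul, hn, Real.norm_eq_abs, Real.norm_eq_abs,
      abs_of_pos (by positivity : 0 < κ * ℓ / 4)]
    nlinarith [mul_le_mul_of_nonneg_right hqt hD.le, mul_le_mul_of_nonneg_right hκ1 hℓ.le]
  · intro z hz
    rw [mem_ball, dist_eq_norm] at hz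
    refine H (a + q • d) ?_ (ℓ / 2) ?_ ?_ z ?_ ?_
    · rw [segment_eq_image']
      exact ⟨q, ⟨by linarith, by linarith⟩, by simp⟩
    · have e : a + q • d - a = q • d := by module
      rw [dist_eq_norm, e, norm_smul, Real.norm_eq_abs, abs_of_nonneg (by linarith)]
      nlinarith
    · have e : a + q • d - (a + d) = -((1 - q) • d) := by module
      rw [dist_eq_norm, e, norm_neg, norm_smul, Real.norm_eq_abs, abs_of_nonneg (by linarith)]
      nlinarith
    · have e : z - (a + q • d) = (z - (a + q • d + (κ * ℓ / 4) • n)) + (κ * ℓ / 4) • n := by module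
      rw [dist_eq_norm, e]
      refine (norm_add_le _ _).trans ?_
      rw [norm_smul, hn, Real.norm_eq_abs, abs_of_pos (by positivity : 0 < κ * ℓ / 4)]
      linarith
    · have e : z - (a + q • d) = (z - (a + q • d + (κ * ℓ / 4) • n)) + (κ * ℓ / 4) • n := by module
      rw [e, inner_add_left, inner_smul_left, real_inner_self_eq_norm_sq, hn]
      have := abs_real_inner_le_norm (z - (a + q • d + (κ * ℓ / 4) • n)) n
      rw [hn, mul_one] at this
      have := neg_le_of_abs_le this
      simp only [conj_trivial]
      linarith

/-- Sets with edges ending in `V`, with disjoint interiors and union `Ω`. -/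
structure IsTiling (κ : ℝ) (K : ℕ) (Ω : Set Plane) (V : Finset Plane) {n : ℕ}
    (R : Fin n → Set Plane) : Prop where
  isClosed : ∀ j, IsClosed (R j)
  null_frontier : ∀ j, volume (frontier (R j)) = 0
  exists_edges : ∀ j, ∃ E : Finset (Plane × Plane), E.card ≤ K ∧
    frontier (R j) = (⋃ e ∈ E, segment ℝ e.1 e.2) ∧
    ∀ e ∈ E, HasHalfDiscs κ (R j) e.1 e.2 ∧ e.1 ∈ V ∧ e.2 ∈ V
  disjoint : ∀ i j, i ≠ j → interior (R i) ∩ interior (R j) = ∅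
  iUnion_eq : ⋃ j, R j = Ω

theorem IsTiling.mono {κ : ℝ} {K : ℕ} {Ω : Set Plane} {V W : Finset Plane} {n : ℕ}
    {R : Fin n → Set Plane} (h : IsTiling κ K Ω V R) (hVW : V ⊆ W) : IsTiling κ K Ω W R := by
  refine ⟨h.1, h.2, fun j => ?_, h.4, h.5⟩
  obtain ⟨E, h1, h2, h3⟩ := h.exists_edges j
  exact ⟨E, h1, h2, fun e he => ⟨(h3 e he).1, hVW (h3 e he).2.1, hVW (h3 e he).2.2⟩⟩

theorem exists_isTiling {κ : ℝ} {K : ℕ} {n : ℕ} {R : Fin n → Set Plane}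
    (hR : ∀ j, HasEdges κ K (R j)) (hdisj : ∀ i j, i ≠ j → interior (R i) ∩ interior (R j) = ∅) :
    ∃ V : Finset Plane, V.card ≤ 2 * K * n ∧ IsTiling κ K (⋃ j, R j) V R := by
  choose E hE1 hE2 hE3 using fun j => (hR j).exists_edges
  refine ⟨Finset.univ.biUnion fun j => (E j).image Prod.fst ∪ (E j).image Prod.snd, ?_,
    fun j => (hR j).isClosed, fun j => (hR j).null_frontier, ?_, hdisj, rfl⟩
  · refine Finset.card_biUnion_le.trans ?_
    have : ∀ j ∈ (Finset.univ : Finset (Fin n)),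
        ((E j).image Prod.fst ∪ (E j).image Prod.snd).card ≤ 2 * K := by
      intro j _
      have a1 := Finset.card_union_le ((E j).image Prod.fst) ((E j).image Prod.snd)
      have a2 := Finset.card_image_le (s := E j) (f := Prod.fst)
      have a3 := Finset.card_image_le (s := E j) (f := Prod.snd)
      have := hE1 j
      omega
    refine (Finset.sum_le_card_nsmul _ _ _ this).trans ?_
    simp [mul_comm]
  · intro j
    refine ⟨E j, hE1 j, hE2 j, fun e he => ⟨hE3 j e he, ?_, ?_⟩⟩
    · exact Finset.mem_biUnion.2 ⟨j, Finset.mem_univ _, Finset.mem_union_left _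
        (Finset.mem_image_of_mem _ he)⟩
    · exact Finset.mem_biUnion.2 ⟨j, Finset.mem_univ _, Finset.mem_union_right _
        (Finset.mem_image_of_mem _ he)⟩

namespace IsTiling

variable {κ : ℝ} {K : ℕ} {Ω : Set Plane} {V : Finset Plane} {n : ℕ} {R : Fin n → Set Plane}

theorem subset (hT : IsTiling κ K Ω V R) (j : Fin n) : R j ⊆ Ω := by
  rw [← hT.iUnion_eq]; exact subset_iUnion R j

theorem exists_edge (hT : IsTiling κ K Ω V R) {j : Fin n} {y : Plane} (hy : y ∈ frontier (R j)) :
    ∃ a ∈ V, ∃ b ∈ V, y ∈ segment ℝ a b ∧ HasHalfDiscs κ (R j) a b := by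
  obtain ⟨E, -, h2, h3⟩ := hT.exists_edges j
  rw [h2, mem_iUnion₂] at hy
  obtain ⟨e, he, hy⟩ := hy
  exact ⟨e.1, (h3 e he).2.1, e.2, (h3 e he).2.2, hy, (h3 e he).1⟩

theorem subset_closure_interior (hT : IsTiling κ K Ω V R) (hκ : 0 < κ) (hκ1 : κ ≤ 1) (j : Fin n) :
    R j ⊆ closure (interior (R j)) := by
  intro y hy
  by_cases hyi : y ∈ interior (R j)
  · exact subset_closure hyi
  have hfr : y ∈ frontier (R j) := ⟨subset_closure hy, hyi⟩
  obtain ⟨a, -, b, -, hyab, hH⟩ := hT.exists_edge hfr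
  rw [Metric.mem_closure_iff]
  intro ε hε
  have hab : 0 < dist a b := dist_pos.2 hH.1
  obtain ⟨z, hz1, hz2⟩ := hH.exists_ball hκ hκ1 hyab (ℓ := min (ε / 2) (dist a b))
    (by positivity) (min_le_right _ _)
  refine ⟨z, interior_maximal hz2 isOpen_ball (mem_ball_self (by positivity)), ?_⟩
  rw [dist_comm]
  have := min_le_left (ε / 2) (dist a b)
  linarith

theorem interior_inter_eq_empty (hT : IsTiling κ K Ω V R) (hκ : 0 < κ) (hκ1 : κ ≤ 1) {i j : Fin n}
    (hij : i ≠ j) {x : Plane} (hx : x ∈ interior (R i)) : x ∉ R j := by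
  intro hj
  obtain ⟨z, hz1, hz2⟩ := mem_closure_iff.1 (hT.subset_closure_interior hκ hκ1 j hj) _
    isOpen_interior hx
  have : z ∈ interior (R i) ∩ interior (R j) := ⟨hz1, hz2⟩
  rw [hT.disjoint i j hij] at this
  exact this

/-- Near a common point of two tiles, away from `V`, the tiles fill two opposite half discs. -/
theorem exists_normal (hT : IsTiling κ K Ω V R) (hκ : 0 < κ) (hκ1 : κ ≤ 1) {i k : Fin n}
    (hik : i ≠ k) {y : Plane} (hi : y ∈ R i) (hk : y ∈ R k) {r : ℝ} (hr : 0 < r)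
    (hrV : ∀ v ∈ V, r ≤ dist y v) :
    ∃ ν : Plane, (∀ z, dist z y ≤ κ * r → 0 ≤ inner ℝ (z - y) ν → z ∈ R i) ∧
      (∀ z, dist z y ≤ κ * r → inner ℝ (z - y) ν ≤ 0 → z ∈ R k) := by
  have hfi : y ∈ frontier (R i) :=
    ⟨subset_closure hi, fun h => hT.interior_inter_eq_empty hκ hκ1 hik h hk⟩
  have hfk : y ∈ frontier (R k) :=
    ⟨subset_closure hk, fun h => hT.interior_inter_eq_empty hκ hκ1 hik.symm h hi⟩
  obtain ⟨a, ha, b, hb, hy, -, ν, hν, -, H⟩ := hT.exists_edge hfi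
  obtain ⟨a', ha', b', hb', hy', -, ν', hν', -, H'⟩ := hT.exists_edge hfk
  have G := H y hy r (hrV a ha) (hrV b hb)
  have G' := H' y hy' r (hrV a' ha') (hrV b' hb')
  have hopp : inner ℝ ν ν' = -1 := by
    by_contra hne
    have hgt : -1 < inner ℝ ν ν' := by
      have := abs_real_inner_le_norm ν ν'
      rw [hν, hν', mul_one] at this
      exact lt_of_le_of_ne (neg_le_of_abs_le this) (Ne.symm hne)
    let U : Set Plane := {z | dist z y < κ * r} ∩ {z | 0 < inner ℝ (z - y) ν} ∩
      {z | 0 < inner ℝ (z - y) ν'}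
    have hU : IsOpen U := by
      refine IsOpen.inter (IsOpen.inter ?_ ?_) ?_
      · exact isOpen_lt (by fun_prop) (by fun_prop)
      · exact isOpen_lt (by fun_prop) (by fun_prop)
      · exact isOpen_lt (by fun_prop) (by fun_prop)
    have hUi : U ⊆ interior (R i) :=
      interior_maximal (fun z hz => G z (le_of_lt hz.1.1) (le_of_lt hz.1.2)) hU
    have hUk : U ⊆ interior (R k) :=
      interior_maximal (fun z hz => G' z (le_of_lt hz.1.1) (le_of_lt hz.2)) hU
    have hmem : y + (κ * r / 4) • (ν + ν') ∈ U := by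
      have hpos : 0 < κ * r / 4 := by positivity
      refine ⟨⟨?_, ?_⟩, ?_⟩
      · show dist _ _ < _
        rw [dist_eq_norm, add_sub_cancel_left, norm_smul, Real.norm_eq_abs, abs_of_pos hpos]
        have := norm_add_le ν ν'
        rw [hν, hν'] at this
        nlinarith
      · show 0 < inner ℝ _ _
        rw [add_sub_cancel_left, inner_smul_left, inner_add_left, real_inner_self_eq_norm_sq, hν,
          real_inner_comm]
        simp only [conj_trivial]
        have : 0 < 1 ^ 2 + inner ℝ ν ν' := by linarith
        positivity
      · show 0 < inner ℝ _ _
        rw [add_sub_cancel_left, inner_smul_left, inner_add_left, real_inner_self_eq_norm_sq, hν']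
        simp only [conj_trivial]
        have : 0 < inner ℝ ν ν' + 1 ^ 2 := by linarith
        positivity
    have : y + (κ * r / 4) • (ν + ν') ∈ interior (R i) ∩ interior (R k) := ⟨hUi hmem, hUk hmem⟩
    rw [hT.disjoint i k hik] at this
    exact this
  have hνν : ν' = -ν := by
    have : ‖ν + ν'‖ ^ 2 = 0 := by rw [norm_add_sq_real, hν, hν', hopp]; norm_num
    have : ν + ν' = 0 := by simpa using this
    exact (neg_eq_of_add_eq_zero_right this).symm
  refine ⟨ν, G, fun z hz hz' => G' z hz ?_⟩
  rw [hνν, inner_neg_right]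
  linarith

theorem exists_crossing (hT : IsTiling κ K Ω V R) {i : Fin n} {x h : Plane} (hx : x ∈ R i)
    (hxh : x + h ∉ R i) (hseg : segment ℝ x (x + h) ⊆ Ω) :
    ∃ k, i ≠ k ∧ ∃ y ∈ segment ℝ x (x + h), y ∈ R i ∧ y ∈ R k := by
  have hpre : IsPreconnected (segment ℝ x (x + h)) := (convex_segment _ _).isPreconnected
  have hcl : IsClosed (⋃ k : {k // i ≠ k}, R k) :=
    isClosed_iUnion_of_finite fun k => hT.isClosed k
  have hcov : segment ℝ x (x + h) ⊆ R i ∪ ⋃ k : {k // i ≠ k}, R k := by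
    intro z hz
    have := hseg hz
    rw [← hT.iUnion_eq, mem_iUnion] at this
    obtain ⟨k, hk⟩ := this
    by_cases hik : i = k
    · left; rw [hik]; exact hk
    · right; exact mem_iUnion.2 ⟨⟨k, hik⟩, hk⟩
  obtain ⟨y, hy, hy1, hy2⟩ := isPreconnected_closed_iff.1 hpre _ _ (hT.isClosed i) hcl hcov
    ⟨x, left_mem_segment _ _ _, hx⟩
    ⟨x + h, right_mem_segment _ _ _, (hcov (right_mem_segment _ _ _)).resolve_left hxh⟩
  obtain ⟨⟨k, hik⟩, hk⟩ := mem_iUnion.1 hy2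
  exact ⟨k, hik, y, hy, hy1, hk⟩

/-- A jump of step `h` far from `V` is a jump across a long straight interface. -/
theorem jump_window (hT : IsTiling κ K Ω V R) (hκ : 0 < κ) (hκ1 : κ ≤ 1) {i : Fin n}
    {x h : Plane} (hx : x ∈ interior (R i)) (hxh : x + h ∉ R i)
    (hseg : segment ℝ x (x + h) ⊆ Ω) {m : ℕ} {r : ℝ} (hr : ∀ v ∈ V, r ≤ dist x v)
    (hm : (m + 2) * ‖h‖ < κ * (r - ‖h‖)) :
    ∃ k, (∀ l : ℕ, l ≤ m → x - (l : ℝ) • h ∈ interior (R i) ∧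
        x + h + (l : ℝ) • h ∈ interior (R k)) ∧
      segment ℝ (x - (m : ℝ) • h) (x + h + (m : ℝ) • h) ⊆ Ω := by
  obtain ⟨k, hik, y, hy, hyi, hyk⟩ := hT.exists_crossing (interior_subset hx) hxh hseg
  rw [segment_eq_image'] at hy
  obtain ⟨t, ⟨ht0, ht1⟩, rfl⟩ := hy
  simp only [add_sub_cancel_left] at *
  set y := x + t • h with hy
  have hh : 0 ≤ ‖h‖ := norm_nonneg h
  have hr0 : 0 < r - ‖h‖ := by
    by_contra hcon
    push Not at hcon
    have h1 : κ * (r - ‖h‖) ≤ 0 := mul_nonpos_of_nonneg_of_nonpos hκ.le hcon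
    have h2 : 0 ≤ ((m : ℝ) + 2) * ‖h‖ := by positivity
    linarith
  have hyx : dist x y ≤ ‖h‖ := by
    rw [hy, dist_eq_norm, sub_add_cancel_left, norm_neg, norm_smul, Real.norm_eq_abs,
      abs_of_nonneg ht0]
    nlinarith
  obtain ⟨ν, G, G'⟩ := hT.exists_normal hκ hκ1 hik hyi hyk hr0 (fun v hv => by
    have := hr v hv
    have := dist_triangle x y v
    linarith)
  have hdist : ∀ u : ℝ, -(m : ℝ) ≤ u → u ≤ m + 1 → dist (x + u • h) y < κ * (r - ‖h‖) := by
    intro u hu1 hu2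
    have e : x + u • h - (x + t • h) = (u - t) • h := by module
    rw [hy, dist_eq_norm, e, norm_smul, Real.norm_eq_abs]
    refine lt_of_le_of_lt ?_ hm
    gcongr
    rw [abs_le]
    constructor <;> linarith
  have hin : ∀ u : ℝ, inner ℝ (x + u • h - y) ν = (u - t) * inner ℝ h ν := by
    intro u
    have e : x + u • h - (x + t • h) = (u - t) • h := by module
    rw [hy, e, inner_smul_left]
    simp
  have e0 : x = x + (0 : ℝ) • h := by module
  have e1 : x + h = x + (1 : ℝ) • h := by module
  have hm0 : (0 : ℝ) ≤ m := Nat.cast_nonneg m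
  have hx0 : 0 < (0 - t) * inner ℝ h ν := by
    by_contra hcon
    push Not at hcon
    rw [← hin, ← e0] at hcon
    refine hT.interior_inter_eq_empty hκ hκ1 hik hx (G' x ?_ hcon)
    have := hdist 0 (by linarith) (by linarith)
    rw [← e0] at this
    exact this.le
  have hx1 : (1 - t) * inner ℝ h ν < 0 := by
    by_contra hcon
    push Not at hcon
    rw [← hin, ← e1] at hcon
    refine hxh (G _ ?_ hcon)
    have := hdist 1 (by linarith) (by linarith)
    rw [← e1] at this
    exact this.le
  have hneg : inner ℝ h ν < 0 := by linarith
  have Gi : ∀ z, dist z y < κ * (r - ‖h‖) → 0 < inner ℝ (z - y) ν → z ∈ interior (R i) := by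
    intro z hz hz'
    refine mem_interior.2 ⟨{z | dist z y < κ * (r - ‖h‖)} ∩ {z | 0 < inner ℝ (z - y) ν},
      fun z hz => G z (le_of_lt hz.1) (le_of_lt hz.2), ?_, hz, hz'⟩
    exact (isOpen_lt (by fun_prop) (by fun_prop)).inter (isOpen_lt (by fun_prop) (by fun_prop))
  have Gk : ∀ z, dist z y < κ * (r - ‖h‖) → inner ℝ (z - y) ν < 0 → z ∈ interior (R k) := by
    intro z hz hz'
    refine mem_interior.2 ⟨{z | dist z y < κ * (r - ‖h‖)} ∩ {z | inner ℝ (z - y) ν < 0},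
      fun z hz => G' z (le_of_lt hz.1) (le_of_lt hz.2), ?_, hz, hz'⟩
    exact (isOpen_lt (by fun_prop) (by fun_prop)).inter (isOpen_lt (by fun_prop) (by fun_prop))
  refine ⟨k, fun l hl => ⟨?_, ?_⟩, ?_⟩
  · have hl' : (l : ℝ) ≤ m := by exact_mod_cast hl
    have hl0 : (0 : ℝ) ≤ l := Nat.cast_nonneg l
    have e : x - (l : ℝ) • h = x + (-(l : ℝ)) • h := by module
    rw [e]
    refine Gi _ (hdist _ (by linarith) (by linarith)) ?_
    rw [hin]
    nlinarith
  · have hl' : (l : ℝ) ≤ m := by exact_mod_cast hl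
    have hl0 : (0 : ℝ) ≤ l := Nat.cast_nonneg l
    have e : x + h + (l : ℝ) • h = x + (1 + (l : ℝ)) • h := by module
    rw [e]
    refine Gk _ (hdist _ (by linarith) (by linarith)) ?_
    rw [hin]
    nlinarith
  · intro z hz
    have hz' : z ∈ ball y (κ * (r - ‖h‖)) := by
      refine (convex_ball y _).segment_subset ?_ ?_ hz
      · have e : x - (m : ℝ) • h = x + (-(m : ℝ)) • h := by module
        rw [e]
        exact hdist _ le_rfl (by linarith)
      · have e : x + h + (m : ℝ) • h = x + (m + 1 : ℝ) • h := by module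
        rw [e]
        exact hdist _ (by linarith) le_rfl
    rcases le_total 0 (inner ℝ (z - y) ν) with h0 | h0
    · exact hT.subset i (G z (le_of_lt hz') h0)
    · exact hT.subset k (G' z (le_of_lt hz') h0)

end IsTiling

theorem deltah_one (Ω : Set Plane) (h : Plane) (f : Plane → ℝ) (x : Plane) :
    deltah Ω 1 h f x = if segment ℝ x (x + h) ⊆ Ω then f (x + h) - f x else 0 := by
  unfold deltah
  simp [Finset.sum_range_succ]
  congr 1
  ring

theorem measurableSet_segment_subset {Ω : Set Plane} (hΩ : IsClosed Ω) (h : Plane) :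
    MeasurableSet {x | segment ℝ x (x + h) ⊆ Ω} := by
  have : {x | segment ℝ x (x + h) ⊆ Ω} = ⋂ t ∈ Icc (0 : ℝ) 1, (fun x => x + t • h) ⁻¹' Ω := by
    ext x
    simp only [segment_eq_image', mem_ofPred_eq, image_subset_iff, mem_iInter, mem_preimage,
      add_sub_cancel_left]
    rfl
  rw [this]
  refine IsClosed.measurableSet (isClosed_biInter fun t _ => hΩ.preimage (by fun_prop))

theorem measurable_deltah_one {Ω : Set Plane} (hΩ : IsClosed Ω) (h : Plane) {f : Plane → ℝ}
    (hf : Measurable f) : Measurable (deltah Ω 1 h f) := by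
  have : deltah Ω 1 h f = fun x => if segment ℝ x (x + h) ⊆ Ω then f (x + h) - f x else 0 :=
    funext (deltah_one Ω h f)
  rw [this]
  exact Measurable.ite (measurableSet_segment_subset hΩ h)
    ((hf.comp (measurable_add_const h)).sub hf) measurable_const

theorem sum_Icc_neg_telescope (G : ℤ → ℝ) (k : ℕ) :
    ∑ i ∈ Finset.Icc (-(k : ℤ)) k, (G (i + 1) - G i) = G (k + 1) - G (-k) := by
  induction k with
  | zero => simp
  | succ k ih =>
    have : Finset.Icc (-((k + 1 : ℕ) : ℤ)) ((k + 1 : ℕ) : ℤ) =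
        insert ((k : ℤ) + 1) (insert (-((k : ℤ) + 1)) (Finset.Icc (-(k : ℤ)) k)) := by
      ext i
      simp only [Finset.mem_insert, Finset.mem_Icc, Nat.cast_add, Nat.cast_one]
      omega
    rw [this, Finset.sum_insert, Finset.sum_insert, ih]
    · push_cast
      have : -((k : ℤ) + 1) + 1 = -k := by ring
      rw [this]
      ring
    · simp
    · simp only [Finset.mem_insert, Finset.mem_Icc]
      omega

theorem enorm_rpow_sum_le {ι : Type*} (s : Finset ι) (F : ι → ℝ) {τ : ℝ} (hτ : 0 < τ)
    (hτ1 : τ ≤ 1) : ‖∑ i ∈ s, F i‖ₑ ^ τ ≤ ∑ i ∈ s, ‖F i‖ₑ ^ τ := by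
  refine Finset.le_sum_of_subadditive (fun y : ℝ => ‖y‖ₑ ^ τ) (by simp [hτ]) (fun y z => ?_) s F
  exact (ENNReal.rpow_le_rpow (enorm_add_le y z) hτ.le).trans
    (ENNReal.rpow_add_le_add_rpow _ _ hτ.le hτ1)

theorem add_smul_mem_segment (x h : Plane) {M a : ℝ} (hM : 0 ≤ M) (h1 : -M ≤ a) (h2 : a ≤ M + 1) :
    x + a • h ∈ segment ℝ (x - M • h) (x + h + M • h) := by
  rw [segment_eq_image']
  have hpos : 0 < 2 * M + 1 := by linarith
  refine ⟨(a + M) / (2 * M + 1), ⟨div_nonneg (by linarith) hpos.le, ?_⟩, ?_⟩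
  · rw [div_le_one hpos]; linarith
  · have e : x + h + M • h - (x - M • h) = (2 * M + 1) • h := by module
    simp only [e, smul_smul, div_mul_cancel₀ _ hpos.ne']
    module

/-- Weight measuring how far `x` is from `V` in units of `t`. -/
def jumpWeight (V : Finset Plane) (t : ℝ) (x : Plane) : ℝ≥0∞ :=
  min 1 (ENNReal.ofReal t / ENNReal.ofReal (infDist x V))

theorem measurable_jumpWeight (V : Finset Plane) (t : ℝ) : Measurable (jumpWeight V t) := by
  unfold jumpWeight
  exact measurable_const.min (measurable_const.div (measurable_infDist.ennreal_ofReal))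

theorem jumpWeight_mono (V : Finset Plane) {t t' : ℝ} (h : t ≤ t') (x : Plane) :
    jumpWeight V t x ≤ jumpWeight V t' x := by
  unfold jumpWeight
  gcongr

theorem inv_succ_le_jumpWeight {V : Finset Plane} {κ t : ℝ} (hκ : 0 < κ) (hκ1 : κ ≤ 1)
    (ht : 0 < t) {m : ℕ} {z : Plane} (hz : κ * infDist z V ≤ 9 * (m + 1) * t) :
    ((m : ℝ≥0∞) + 1)⁻¹ ≤ ENNReal.ofReal (9 / κ) * jumpWeight V t z := by
  have e : ((m : ℝ≥0∞) + 1)⁻¹ = ENNReal.ofReal ((m + 1 : ℝ)⁻¹) := by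
    rw [ENNReal.ofReal_inv_of_pos (by positivity), ENNReal.ofReal_add (by positivity) (by norm_num)]
    simp
  unfold jumpWeight
  rw [e, mul_min]
  refine le_min ?_ ?_
  · rw [mul_one]
    apply ENNReal.ofReal_le_ofReal
    calc (m + 1 : ℝ)⁻¹ ≤ 1 := inv_le_one_of_one_le₀ (by simp)
      _ ≤ 9 / κ := by rw [le_div_iff₀ hκ]; linarith
  · rcases (infDist_nonneg (x := z) (s := (V : Set Plane))).eq_or_lt with h0 | h0
    · rw [← h0, ENNReal.ofReal_zero, ENNReal.div_zero (by simpa using ht), ENNReal.mul_top]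
      · exact le_top
      · simp only [ne_eq, ENNReal.ofReal_eq_zero, not_le]; positivity
    · rw [← ENNReal.ofReal_div_of_pos h0, ← ENNReal.ofReal_mul (by positivity)]
      apply ENNReal.ofReal_le_ofReal
      rw [inv_eq_one_div, div_mul_div_comm, div_le_div_iff₀ (by positivity) (by positivity)]
      linarith

/-- The first difference of a piecewise constant `f` against the one of an arbitrary `g`. -/
theorem IsTiling.lintegral_deltah_le {κ : ℝ} {K : ℕ} {Ω : Set Plane} {V : Finset Plane} {n : ℕ}
    {R : Fin n → Set Plane} (hT : IsTiling κ K Ω V R) (hκ : 0 < κ) (hκ1 : κ ≤ 1)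
    (hΩ : IsClosed Ω) {f g : Plane → ℝ} (hf : Measurable f) (hg : Measurable g)
    {c : Fin n → ℝ} (hfc : ∀ j, ∀ x ∈ interior (R j), f x = c j) {τ : ℝ} (hτ : 0 < τ)
    (hτ1 : τ ≤ 1) (h : Plane) :
    ∫⁻ x in Ω, ‖deltah Ω 1 h f x‖ₑ ^ τ ≤ (∫⁻ x in Ω, ‖deltah Ω 1 h g x‖ₑ ^ τ) +
      ENNReal.ofReal (18 / κ) * ∫⁻ x in Ω, ‖f x - g x‖ₑ ^ τ * jumpWeight V ‖h‖ x := by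
  by_cases hh : h = 0
  · have : ∀ x, deltah Ω 1 h f x = 0 := by intro x; rw [deltah_one, hh]; simp
    simp [this, hτ]
  have hh0 : 0 < ‖h‖ := norm_pos_iff.2 hh
  let G : Set Plane := ⋃ j, interior (R j)
  let J : Set Plane := {x | x ∈ G} ∩ {x | x + h ∈ G} ∩ {x | segment ℝ x (x + h) ⊆ Ω} ∩
    {x | f x ≠ f (x + h)}
  have hG : MeasurableSet G := (isOpen_iUnion fun j => isOpen_interior).measurableSet
  have hJ : MeasurableSet J := by
    refine ((hG.inter (hG.preimage (measurable_add_const h))).inter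
      (measurableSet_segment_subset hΩ h)).inter ?_
    exact (measurableSet_eq_fun hf (hf.comp (measurable_add_const h))).compl
  let ρ : Plane → ℝ := fun x => infDist x V
  have hρ0 : ∀ x, 0 ≤ ρ x := fun x => infDist_nonneg
  let m : Plane → ℕ := fun x => ⌊κ * ρ x / (8 * ‖h‖)⌋₊
  have hmm : Measurable m :=
    Nat.measurable_floor.comp ((measurable_infDist.const_mul κ).div_const _)
  have hm1 : ∀ x, (8 * m x : ℝ) * ‖h‖ ≤ κ * ρ x := by
    intro x
    have := Nat.floor_le (a := κ * ρ x / (8 * ‖h‖))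
      (div_nonneg (mul_nonneg hκ.le (hρ0 x)) (by positivity))
    rw [le_div_iff₀ (by positivity)] at this
    linarith
  have hm2 : ∀ x, κ * ρ x ≤ (8 * (m x + 1) : ℝ) * ‖h‖ := by
    intro x
    have := (Nat.lt_floor_add_one (κ * ρ x / (8 * ‖h‖))).le
    rw [div_le_iff₀ (by positivity)] at this
    linarith
  have hwin : ∀ x ∈ J, (∀ l : ℕ, l ≤ 2 * m x → f (x - (l : ℝ) • h) = f x ∧
      f (x + h + (l : ℝ) • h) = f (x + h)) ∧
      segment ℝ (x - ((2 * m x : ℕ) : ℝ) • h) (x + h + ((2 * m x : ℕ) : ℝ) • h) ⊆ Ω := by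
    rintro x ⟨⟨⟨hx1, hx2⟩, hx3⟩, hx4⟩
    rcases Nat.eq_zero_or_pos (m x) with h0 | h0
    · rw [h0]
      refine ⟨fun l hl => ?_, by simpa using hx3⟩
      have : l = 0 := by omega
      subst this
      simp
    obtain ⟨i, hi⟩ := mem_iUnion.1 hx1
    obtain ⟨k, hk⟩ := mem_iUnion.1 hx2
    have hik : i ≠ k := by
      rintro rfl
      exact hx4 (by rw [hfc i x hi, hfc i _ hk])
    have hxh : x + h ∉ R i := hT.interior_inter_eq_empty hκ hκ1 hik.symm hk
    have hm0 : (1 : ℝ) ≤ m x := by exact_mod_cast h0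
    obtain ⟨k', hk', hseg⟩ := hT.jump_window hκ hκ1 (m := 2 * m x) (r := ρ x) hi hxh hx3
      (fun v hv => infDist_le_dist_of_mem hv) (by
        have := hm1 x
        push_cast
        nlinarith)
    refine ⟨fun l hl => ?_, hseg⟩
    have h2 := (hk' 0 (Nat.zero_le _)).2
    simp only [Nat.cast_zero, zero_smul, add_zero] at h2
    rw [hfc i x hi, hfc i _ (hk' l hl).1, hfc k' _ (hk' l hl).2, hfc k' _ h2]
    exact ⟨rfl, rfl⟩
  have hsegk : ∀ x ∈ J, ∀ a : ℝ, -(m x : ℝ) ≤ a → a ≤ m x + 1 → x + a • h ∈ Ω := by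
    intro x hx a h1 h2
    apply (hwin x hx).2
    apply add_smul_mem_segment
    · positivity
    · push_cast; have : (0 : ℝ) ≤ m x := by positivity
      linarith
    · push_cast; have : (0 : ℝ) ≤ m x := by positivity
      linarith
  let a : Plane → ℝ≥0∞ := fun x => ‖deltah Ω 1 h f x‖ₑ ^ τ
  let b : Plane → ℝ≥0∞ := fun x => ‖deltah Ω 1 h g x‖ₑ ^ τ
  let u : Plane → ℝ≥0∞ := Ω.indicator fun x => ‖f x - g x‖ₑ ^ τ
  have hbm : Measurable b := (measurable_deltah_one hΩ h hg).enorm.pow_const τ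
  have hum : Measurable u := ((hf.sub hg).enorm.pow_const τ).indicator hΩ.measurableSet
  have hwm : Measurable fun x => ENNReal.ofReal (9 / κ) * jumpWeight V ‖h‖ x :=
    (measurable_jumpWeight V ‖h‖).const_mul _
  have main := setLIntegral_le_of_windows h hh (a := a) hbm hum hwm hJ m
    (fun k => hJ.inter (hmm measurableSet_Ici)) ?_ ?_ ?_ ?_
  · calc ∫⁻ x in Ω, a x ≤ ∫⁻ x in J, a x := by
          rw [← lintegral_indicator hΩ.measurableSet, ← lintegral_indicator hJ]
          have hZ : volume (⋃ j, frontier (R j)) = 0 :=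
            measure_iUnion_null fun j => hT.null_frontier j
          have hZ' : volume ((fun x => x + h) ⁻¹' ⋃ j, frontier (R j)) = 0 := by
            rw [measure_preimage_add_right]; exact hZ
          have a1 : ∀ᵐ x, x ∉ ⋃ j, frontier (R j) := measure_eq_zero_iff_ae_notMem.1 hZ
          have a2 : ∀ᵐ x, x + h ∉ ⋃ j, frontier (R j) := measure_eq_zero_iff_ae_notMem.1 hZ'
          refine lintegral_mono_ae ?_
          filter_upwards [a1, a2] with x h1 h2
          by_cases hxJ : x ∈ J
          · rw [indicator_of_mem hxJ]; exact indicator_le_self _ _ _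
          · have hΩG : ∀ z, z ∈ Ω → z ∉ ⋃ j, frontier (R j) → z ∈ G := by
              intro z hz hz'
              rw [← hT.iUnion_eq, mem_iUnion] at hz
              obtain ⟨j, hj⟩ := hz
              refine mem_iUnion.2 ⟨j, ?_⟩
              by_contra hcon
              exact hz' (mem_iUnion.2 ⟨j, subset_closure hj, hcon⟩)
            have : a x = 0 := by
              show ‖deltah Ω 1 h f x‖ₑ ^ τ = 0
              rw [deltah_one]
              split_ifs with hs
              · have : f x = f (x + h) := by
                  by_contra hne
                  exact hxJ ⟨⟨⟨hΩG x (hs (left_mem_segment _ _ _)) h1,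
                    hΩG _ (hs (right_mem_segment _ _ _)) h2⟩, hs⟩, hne⟩
                rw [this]; simp [hτ]
              · simp [hτ]
            rw [indicator_of_notMem hxJ, indicator_apply, this]
            simp
      _ ≤ (∫⁻ x, b x) + 2 * ∫⁻ x, u x * (ENNReal.ofReal (9 / κ) * jumpWeight V ‖h‖ x) := main
      _ = _ := by
          congr 1
          · rw [← lintegral_indicator hΩ.measurableSet]
            congr 1
            funext x
            by_cases hx : x ∈ Ω
            · rw [indicator_of_mem hx]
            · rw [indicator_of_notMem hx]
              show ‖deltah Ω 1 h g x‖ₑ ^ τ = 0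
              rw [deltah_one, if_neg (fun hs => hx (hs (left_mem_segment _ _ _)))]
              simp [hτ]
          · have e : ∀ x, u x * (ENNReal.ofReal (9 / κ) * jumpWeight V ‖h‖ x) =
                ENNReal.ofReal (9 / κ) *
                  Ω.indicator (fun x => ‖f x - g x‖ₑ ^ τ * jumpWeight V ‖h‖ x) x := by
              intro x
              simp only [u, indicator_apply]
              split_ifs
              · ring
              · simp
            simp_rw [e]
            rw [lintegral_const_mul', lintegral_indicator hΩ.measurableSet, ← mul_assoc]
            · congr 1
              rw [show (2 : ℝ≥0∞) = ENNReal.ofReal 2 by simp, ← ENNReal.ofReal_mul (by norm_num)]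
              congr 1
              ring
            · exact ENNReal.ofReal_ne_top
  · intro x hx k hk
    have hkm : (k : ℝ) ≤ m x := by exact_mod_cast hk
    have hk0 : (0 : ℝ) ≤ k := Nat.cast_nonneg k
    have hw := (hwin x hx).1 k (by omega)
    have e1 : x - (k : ℝ) • h = x + (-(k : ℝ)) • h := by module
    have e2 : x + h + (k : ℝ) • h = x + ((k : ℝ) + 1) • h := by module
    have hd : deltah Ω 1 h f x = (f (x + h + (k : ℝ) • h) - g (x + h + (k : ℝ) • h)) -
        (f (x - (k : ℝ) • h) - g (x - (k : ℝ) • h)) +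
        ∑ i ∈ Finset.Icc (-(k : ℤ)) k, deltah Ω 1 h g (x + (i : ℝ) • h) := by
      have hs : ∀ i ∈ Finset.Icc (-(k : ℤ)) k, deltah Ω 1 h g (x + (i : ℝ) • h) =
          (fun i : ℤ => g (x + (i : ℝ) • h)) (i + 1) - (fun i : ℤ => g (x + (i : ℝ) • h)) i := by
        intro i hi
        rw [Finset.mem_Icc] at hi
        have i1 : -(k : ℝ) ≤ i := by exact_mod_cast hi.1
        have i2 : (i : ℝ) ≤ k := by exact_mod_cast hi.2
        have e3 : x + (i : ℝ) • h + h = x + ((i : ℝ) + 1) • h := by module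
        rw [deltah_one, if_pos, e3]
        · push_cast; rfl
        · rw [e3]
          have hc : segment ℝ (x + (i : ℝ) • h) (x + ((i : ℝ) + 1) • h) ⊆
              segment ℝ (x - ((2 * m x : ℕ) : ℝ) • h) (x + h + ((2 * m x : ℕ) : ℝ) • h) := by
            apply (convex_segment _ _).segment_subset <;> apply add_smul_mem_segment <;>
              push_cast <;> linarith
          exact hc.trans (hwin x hx).2
      rw [Finset.sum_congr rfl hs, sum_Icc_neg_telescope (fun i : ℤ => g (x + (i : ℝ) • h)),
        deltah_one, if_pos (show segment ℝ x (x + h) ⊆ Ω from hx.1.2), hw.1, hw.2, e1, e2]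
      push_cast
      ring
    show ‖deltah Ω 1 h f x‖ₑ ^ τ ≤ _
    have hu1 : u (x - (k : ℝ) • h) = ‖f (x - (k : ℝ) • h) - g (x - (k : ℝ) • h)‖ₑ ^ τ := by
      refine indicator_of_mem ?_ _
      rw [e1]; exact hsegk x hx _ (by linarith) (by linarith)
    have hu2 : u (x + h + (k : ℝ) • h) =
        ‖f (x + h + (k : ℝ) • h) - g (x + h + (k : ℝ) • h)‖ₑ ^ τ := by
      refine indicator_of_mem ?_ _
      rw [e2]; exact hsegk x hx _ (by linarith) (by linarith)
    rw [hd, hu1, hu2]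
    refine (ENNReal.rpow_le_rpow (enorm_add_le _ _) hτ.le).trans ?_
    refine (ENNReal.rpow_add_le_add_rpow _ _ hτ.le hτ1).trans ?_
    refine add_le_add ?_ (enorm_rpow_sum_le _ _ hτ hτ1)
    refine (ENNReal.rpow_le_rpow enorm_sub_le hτ.le).trans ?_
    refine (ENNReal.rpow_add_le_add_rpow _ _ hτ.le hτ1).trans ?_
    rw [add_comm]
  · have aux : ∀ x ∈ J, ∀ x' ∈ J, ∀ j : ℕ, 0 < j → j ≤ m x + m x' → x' = x + (j : ℝ) • h →
        False := by
      intro x hx x' hx' j hj hjm e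
      have ej : (((j - 1 : ℕ) : ℕ) : ℝ) = (j : ℝ) - 1 := by
        rw [Nat.cast_sub (by omega)]; simp
      rcases le_total (m x) (m x') with hle | hle
      · have w1 := ((hwin x' hx').1 j (by omega)).1
        have w2 := ((hwin x' hx').1 (j - 1) (by omega)).1
        have z1 : x' - (j : ℝ) • h = x := by rw [e]; module
        have z2 : x' - ((j - 1 : ℕ) : ℝ) • h = x + h := by rw [e, ej]; module
        rw [z1] at w1
        rw [z2] at w2
        exact hx.2 (w1.trans w2.symm)
      · have w1 := ((hwin x hx).1 j (by omega)).2
        have w2 := ((hwin x hx).1 (j - 1) (by omega)).2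
        have z1 : x + h + (j : ℝ) • h = x' + h := by rw [e]; module
        have z2 : x + h + ((j - 1 : ℕ) : ℝ) • h = x' := by rw [e, ej]; module
        rw [z1] at w1
        rw [z2] at w2
        exact hx'.2 (w2.trans w1.symm)
    intro x hx x' hx' i i' hi hi' e
    by_contra hne
    rcases lt_trichotomy i i' with hlt | heq | hgt
    · refine aux x' hx' x hx (i' - i).toNat (by omega) (by omega) ?_
      have : (((i' - i).toNat : ℕ) : ℝ) = (i' : ℝ) - i := by
        have h1 : (((i' - i).toNat : ℕ) : ℤ) = i' - i := Int.toNat_of_nonneg (by omega)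
        exact_mod_cast h1
      rw [this, sub_smul, add_sub_assoc', ← e]
      abel
    · rw [heq] at e
      exact hne (add_right_cancel e)
    · refine aux x hx x' hx' (i - i').toNat (by omega) (by omega) ?_
      have : (((i - i').toNat : ℕ) : ℝ) = (i : ℝ) - i' := by
        have h1 : (((i - i').toNat : ℕ) : ℤ) = i - i' := Int.toNat_of_nonneg (by omega)
        exact_mod_cast h1
      rw [this, sub_smul, add_sub_assoc', e]
      abel
  all_goals
    intro x hx k hk
    apply inv_succ_le_jumpWeight hκ hκ1 hh0
    have hkm : (k : ℝ) ≤ m x := by exact_mod_cast hk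
    have hk0 : (0 : ℝ) ≤ k := Nat.cast_nonneg k
    have h2 := hm2 x
  · have h3 : infDist (x - (k : ℝ) • h) V ≤ ρ x + (m x + 1) * ‖h‖ := by
      refine (infDist_le_infDist_add_dist (y := x)).trans ?_
      gcongr
      rw [dist_eq_norm, sub_sub_cancel_left, norm_neg, norm_smul,
        Real.norm_eq_abs, abs_of_nonneg hk0]
      nlinarith
    have h4 : 0 ≤ (m x + 1 : ℝ) * ‖h‖ := by positivity
    nlinarith [mul_le_mul_of_nonneg_left h3 hκ.le, mul_le_mul_of_nonneg_right hκ1 h4]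
  · have h3 : infDist (x + h + (k : ℝ) • h) V ≤ ρ x + (m x + 1) * ‖h‖ := by
      refine (infDist_le_infDist_add_dist (y := x)).trans ?_
      gcongr
      have e : x + h + (k : ℝ) • h - x = (k + 1 : ℝ) • h := by module
      rw [dist_eq_norm, e, norm_smul, Real.norm_eq_abs, abs_of_nonneg (by positivity)]
      nlinarith
    have h4 : 0 ≤ (m x + 1 : ℝ) * ‖h‖ := by positivity
    nlinarith [mul_le_mul_of_nonneg_left h3 hκ.le, mul_le_mul_of_nonneg_right hκ1 h4]

theorem ennreal_rpow_neg_anti {θ : ℝ} (hθ : 0 ≤ θ) {a b : ℝ≥0∞} (h : a ≤ b) :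
    b ^ (-θ) ≤ a ^ (-θ) := by
  rw [ENNReal.rpow_neg, ENNReal.rpow_neg, ENNReal.inv_le_inv]
  exact ENNReal.rpow_le_rpow h hθ

theorem half_pow_eq_rpow (m : ℕ) : (1 / 2 : ℝ) ^ m = 2 ^ (-(m : ℝ)) := by
  rw [Real.rpow_neg (by norm_num), Real.rpow_natCast, one_div, inv_pow]

/-- The integral of a subcritical power of the distance over a disc. -/
theorem exists_lintegral_ball_dist_rpow_le {θ : ℝ} (hθ : 0 < θ) (hθ1 : θ < 1) :
    ∃ C : ℝ≥0∞, C ≠ ⊤ ∧ ∀ (v : Plane) (r : ℝ), 0 < r →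
      ∫⁻ x in ball v r, ENNReal.ofReal (dist x v) ^ (-θ) ≤ C * ENNReal.ofReal r ^ (2 - θ) := by
  let A : ℕ → ℝ := fun k => 2 ^ θ * Real.pi * ((2 : ℝ) ^ (-(2 - θ))) ^ k
  have hg0 : (0 : ℝ) ≤ 2 ^ (-(2 - θ)) := by positivity
  have hg1 : (2 : ℝ) ^ (-(2 - θ)) < 1 :=
    Real.rpow_lt_one_of_one_lt_of_neg (by norm_num) (by linarith)
  have hA0 : ∀ k, 0 ≤ A k := fun k => by positivity
  have hA : Summable A := (summable_geometric_of_lt_one hg0 hg1).mul_left _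
  refine ⟨∑' k, ENNReal.ofReal (A k), ?_, fun v r hr => ?_⟩
  · rw [← ENNReal.ofReal_tsum_of_nonneg hA0 hA]
    exact ENNReal.ofReal_ne_top
  let S : ℕ → Set Plane := fun k =>
    {x | r * (1 / 2) ^ (k + 1) < dist x v ∧ dist x v ≤ r * (1 / 2) ^ k}
  have hcov : ball v r ⊆ {v} ∪ ⋃ k, S k := by
    intro x hx
    rcases eq_or_ne x v with h | h
    · exact Or.inl h
    · right
      have hd : 0 < dist x v := dist_pos.2 h
      obtain ⟨k, h1, h2⟩ := exists_nat_pow_near_of_lt_one (x := dist x v / r) (y := 1 / 2)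
        (by positivity) (by rw [div_le_one hr]; exact (mem_ball.1 hx).le) (by norm_num)
        (by norm_num)
      rw [lt_div_iff₀ hr] at h1
      rw [div_le_iff₀ hr] at h2
      exact mem_iUnion.2 ⟨k, by linarith, by linarith⟩
  calc ∫⁻ x in ball v r, ENNReal.ofReal (dist x v) ^ (-θ)
      ≤ ∫⁻ x in {v} ∪ ⋃ k, S k, ENNReal.ofReal (dist x v) ^ (-θ) := lintegral_mono_set hcov
    _ ≤ (∫⁻ x in ({v} : Set Plane), ENNReal.ofReal (dist x v) ^ (-θ)) +
        ∫⁻ x in ⋃ k, S k, ENNReal.ofReal (dist x v) ^ (-θ) := lintegral_union_le _ _ _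
    _ = ∫⁻ x in ⋃ k, S k, ENNReal.ofReal (dist x v) ^ (-θ) := by
        rw [setLIntegral_measure_zero _ _ (by simp), zero_add]
    _ ≤ ∑' k, ∫⁻ x in S k, ENNReal.ofReal (dist x v) ^ (-θ) := lintegral_iUnion_le _ _
    _ ≤ ∑' k, ENNReal.ofReal (A k) * ENNReal.ofReal r ^ (2 - θ) := by
        refine ENNReal.tsum_le_tsum fun k => ?_
        have h1 : 0 < r * (1 / 2) ^ (k + 1) := by positivity
        have h2 : 0 < r * (1 / 2) ^ k := by positivity
        have hS : MeasurableSet (S k) := by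
          have hm : Measurable fun x : Plane => dist x v := measurable_id.dist measurable_const
          exact (measurableSet_lt measurable_const hm).inter (measurableSet_le hm measurable_const)
        calc ∫⁻ x in S k, ENNReal.ofReal (dist x v) ^ (-θ)
            ≤ ∫⁻ x in S k, ENNReal.ofReal ((r * (1 / 2) ^ (k + 1)) ^ (-θ)) := by
              refine setLIntegral_mono measurable_const fun x hx => ?_
              rw [← ENNReal.ofReal_rpow_of_pos h1]
              exact ennreal_rpow_neg_anti hθ.le (ENNReal.ofReal_le_ofReal hx.1.le)
          _ ≤ ENNReal.ofReal ((r * (1 / 2) ^ (k + 1)) ^ (-θ)) *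
                volume (closedBall v (r * (1 / 2) ^ k)) := by
              rw [setLIntegral_const]
              gcongr
              exact fun x hx => mem_closedBall.2 hx.2
          _ = ENNReal.ofReal (A k) * ENNReal.ofReal r ^ (2 - θ) := by
              rw [EuclideanSpace.volume_closedBall_fin_two, ENNReal.ofReal_rpow_of_pos hr,
                ← ENNReal.ofReal_mul (hA0 k), ← ENNReal.ofReal_pow h2.le,
                ← ENNReal.ofReal_mul (by positivity),
                ← ENNReal.ofReal_mul (by positivity)]
              congr 1
              simp only [A]
              rw [Real.mul_rpow hr.le (by positivity), half_pow_eq_rpow, half_pow_eq_rpow,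
                ← Real.rpow_mul (by norm_num), ← Real.rpow_natCast ((2 : ℝ) ^ (-(2 - θ))) k,
                ← Real.rpow_mul (by norm_num), show (2 : ℝ) - θ = 2 + -θ by ring,
                Real.rpow_add hr, mul_pow, ← Real.rpow_natCast ((2 : ℝ) ^ (-(k : ℝ))) 2,
                ← Real.rpow_mul (by norm_num)]
              have e : (2 : ℝ) ^ θ * (2 : ℝ) ^ (-(2 + -θ) * k) =
                  (2 : ℝ) ^ (-((k + 1 : ℕ) : ℝ) * -θ) * (2 : ℝ) ^ (-(k : ℝ) * (2 : ℕ)) := by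
                rw [← Real.rpow_add (by norm_num), ← Real.rpow_add (by norm_num)]
                congr 1
                push_cast
                ring
              rw [Real.rpow_two]
              linear_combination -(Real.pi * r ^ 2 * r ^ (-θ)) * e
    _ = _ := ENNReal.tsum_mul_right

/-- The integral of a subcritical power of the distance over a set of given measure. -/
theorem exists_setLIntegral_dist_rpow_le {θ : ℝ} (hθ : 0 < θ) (hθ1 : θ < 1) :
    ∃ C : ℝ≥0∞, C ≠ ⊤ ∧ ∀ (v : Plane) (Z : Set Plane), volume Z ≠ ⊤ →
      ∫⁻ x in Z, ENNReal.ofReal (dist x v) ^ (-θ) ≤ C * volume Z ^ (1 - θ / 2) := by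
  obtain ⟨C, hC, h⟩ := exists_lintegral_ball_dist_rpow_le hθ hθ1
  refine ⟨C + 1, by simp [hC], fun v Z hZ => ?_⟩
  rcases eq_or_ne (volume Z) 0 with h0 | h0
  · rw [setLIntegral_measure_zero _ _ h0]
    exact zero_le
  set r : ℝ := Real.sqrt (volume Z).toReal
  have hm : 0 < (volume Z).toReal := ENNReal.toReal_pos h0 hZ
  have hr : 0 < r := Real.sqrt_pos.2 hm
  have e : ENNReal.ofReal r = volume Z ^ (1 / 2 : ℝ) := by
    conv_rhs => rw [← ENNReal.ofReal_toReal hZ]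
    rw [ENNReal.ofReal_rpow_of_pos hm, ← Real.sqrt_eq_rpow]
  have hsplit : Z ⊆ ball v r ∪ (Z \ ball v r) := fun x hx => by
    by_cases hb : x ∈ ball v r
    · exact Or.inl hb
    · exact Or.inr ⟨hx, hb⟩
  calc ∫⁻ x in Z, ENNReal.ofReal (dist x v) ^ (-θ)
      ≤ _ := lintegral_mono_set hsplit
    _ ≤ _ := lintegral_union_le _ _ _
    _ ≤ C * ENNReal.ofReal r ^ (2 - θ) + ENNReal.ofReal r ^ (-θ) * volume Z := by
        refine add_le_add (h v r hr) ?_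
        calc ∫⁻ x in Z \ ball v r, ENNReal.ofReal (dist x v) ^ (-θ)
            ≤ ∫⁻ x in Z \ ball v r, ENNReal.ofReal r ^ (-θ) := by
              refine setLIntegral_mono measurable_const fun x hx => ?_
              refine ennreal_rpow_neg_anti hθ.le (ENNReal.ofReal_le_ofReal ?_)
              simpa using hx.2
          _ ≤ _ := by
              rw [setLIntegral_const]
              gcongr
              exact sdiff_subset
    _ = (C + 1) * volume Z ^ (1 - θ / 2) := by
        rw [e, ← ENNReal.rpow_mul, ← ENNReal.rpow_mul, add_mul, one_mul]
        congr 2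
        · ring_nf
        · nth_rewrite 2 [← ENNReal.rpow_one (volume Z)]
          rw [← ENNReal.rpow_add _ _ h0 hZ]
          congr 1
          ring

/-- One step of the greedy (farthest point) selection. -/
theorem exists_greedy_radii_of_subset {V : Finset Plane} {T : ℝ} (m : ℕ) :
    ∀ (W : Finset Plane) (r : Plane → ℝ), W.Nonempty → W ⊆ V → (V \ W).card = m →
      (∀ w ∈ W, 0 < r w) → (∀ w ∈ W, ∀ z ∈ V, infDist z W ≤ r w) →
      (∀ v ∈ W, ∀ w ∈ W, v ≠ w → min (r v) (r w) ≤ dist v w) →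
      (∀ t ≤ T, (∀ z ∈ V, infDist z W ≤ t) → ∀ z ∈ V, ∃ w ∈ W, t ≤ r w ∧ dist z w ≤ t) →
      ∃ r' : Plane → ℝ, (∀ w ∈ V, 0 < r' w) ∧
        (∀ v ∈ V, ∀ w ∈ V, v ≠ w → min (r' v) (r' w) ≤ dist v w) ∧
        ∀ t ≤ T, 0 ≤ t → ∀ z ∈ V, ∃ w ∈ V, t ≤ r' w ∧ dist z w ≤ t := by
  induction m with
  | zero =>
    intro W r hW hWV hc h0 h1 h2 h3
    have e : W = V := by
      rw [Finset.card_eq_zero, Finset.sdiff_eq_empty_iff_subset] at hc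
      exact hWV.antisymm hc
    subst e
    refine ⟨r, h0, h2, fun t ht ht0 => h3 t ht fun z hz => ?_⟩
    rw [infDist_zero_of_mem (by exact_mod_cast hz)]
    exact ht0
  | succ m ih =>
    intro W r hW hWV hc h0 h1 h2 h3
    have hne : (V \ W).Nonempty := Finset.card_pos.1 (by omega)
    have hWne : (W : Set Plane).Nonempty := hW
    obtain ⟨z, hz, hmax⟩ := (V \ W).exists_max_image (fun z => infDist z (W : Set Plane)) hne
    rw [Finset.mem_sdiff] at hz
    set d : ℝ := infDist z (W : Set Plane)
    have hd : 0 < d := (W.finite_toSet.isClosed.notMem_iff_infDist_pos hWne).1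
      (by exact_mod_cast hz.2)
    have hmax' : ∀ y ∈ V, infDist y (W : Set Plane) ≤ d := by
      intro y hy
      by_cases hyW : y ∈ W
      · rw [infDist_zero_of_mem (by exact_mod_cast hyW)]; exact hd.le
      · exact hmax y (Finset.mem_sdiff.2 ⟨hy, hyW⟩)
    have hins : ∀ y, infDist y (insert z W : Finset Plane) ≤ infDist y (W : Set Plane) := fun y =>
      infDist_le_infDist_of_subset (by simp) hWne
    have hr : ∀ w ∈ W, Function.update r z d w = r w := fun w hw =>
      Function.update_of_ne (ne_of_mem_of_not_mem hw hz.2) _ _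
    have hrz : Function.update r z d z = d := Function.update_self ..
    refine ih (insert z W) (Function.update r z d) (Finset.insert_nonempty _ _)
      (Finset.insert_subset hz.1 hWV) ?_ ?_ ?_ ?_ ?_
    · rw [Finset.sdiff_insert, Finset.card_erase_of_mem (Finset.mem_sdiff.2 hz), hc]
      rfl
    · intro w hw
      rcases Finset.mem_insert.1 hw with rfl | hw
      · rwa [hrz]
      · rw [hr w hw]; exact h0 w hw
    · intro w hw y hy
      rcases Finset.mem_insert.1 hw with rfl | hw
      · rw [hrz]; exact (hins y).trans (hmax' y hy)
      · rw [hr w hw]; exact (hins y).trans (h1 w hw y hy)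
    · intro v hv w hw hvw
      rcases Finset.mem_insert.1 hv with rfl | hv' <;> rcases Finset.mem_insert.1 hw with rfl | hw'
      · exact absurd rfl hvw
      · exact (min_le_left _ _).trans (hrz.le.trans
          (infDist_le_dist_of_mem (by exact_mod_cast hw')))
      · rw [dist_comm]
        exact (min_le_right _ _).trans (hrz.le.trans
          (infDist_le_dist_of_mem (Finset.mem_coe.2 hv')))
      · rw [hr v hv', hr w hw']; exact h2 v hv' w hw' hvw
    · intro t ht hcov y hy
      rcases le_or_gt d t with hdt | hdt
      · obtain ⟨w, hw, hw1, hw2⟩ := h3 t ht (fun y hy => (hmax' y hy).trans hdt) y hy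
        exact ⟨w, Finset.mem_insert_of_mem hw, by rwa [hr w hw], hw2⟩
      · obtain ⟨w, hw, hw'⟩ := (insert z W).finite_toSet.isCompact.exists_infDist_eq_dist
          (by simp) y
        have hw : w ∈ insert z W := by exact_mod_cast hw
        refine ⟨w, hw, ?_, hw' ▸ hcov y hy⟩
        rcases Finset.mem_insert.1 hw with rfl | hw
        · rw [hrz]; exact hdt.le
        · rw [hr w hw]; exact hdt.le.trans (h1 w hw z hz.1)

/-- Radii attached to the points of a finite set such that the points with radius at least `t`
form a `t`-net, for all scales `t ≤ T` simultaneously. -/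
theorem exists_greedy_radii {V : Finset Plane} (hV : V.Nonempty) (T : ℝ) :
    ∃ r : Plane → ℝ, (∀ w ∈ V, 0 < r w) ∧
      (∀ v ∈ V, ∀ w ∈ V, v ≠ w → min (r v) (r w) ≤ dist v w) ∧
      ∀ t ≤ T, 0 ≤ t → ∀ z ∈ V, ∃ w ∈ V, t ≤ r w ∧ dist z w ≤ t := by
  obtain ⟨v, hv⟩ := hV
  have hb : ∀ z ∈ V, dist z v ≤ diam (V : Set Plane) := fun z hz =>
    dist_le_diam_of_mem V.finite_toSet.isBounded (by exact_mod_cast hz) (by exact_mod_cast hv)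
  have hd : 0 ≤ diam (V : Set Plane) := diam_nonneg
  refine exists_greedy_radii_of_subset _ {v} (fun _ => max T (diam (V : Set Plane) + 1))
    (Finset.singleton_nonempty v) (by simpa using hv) rfl ?_ ?_ ?_ ?_
  · intro w _
    exact lt_max_of_lt_right (by linarith)
  · intro w _ z hz
    have := hb z hz
    simp only [Finset.coe_singleton, infDist_singleton]
    exact le_max_of_le_right (by linarith)
  · intro a ha b hb hab
    simp only [Finset.mem_singleton] at ha hb
    exact absurd (ha.trans hb.symm) hab
  · intro t ht hcov z hz
    refine ⟨v, Finset.mem_singleton_self v, le_max_of_le_left ht, ?_⟩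
    simpa using hcov z hz

/-- Points at which `V` shows at least two well separated points at the scale of the distance
to `V`. -/
def spreadSet (V : Finset Plane) : Set Plane :=
  {x | ∃ v ∈ V, ∃ w ∈ V, dist x v ≤ 10 * infDist x V ∧ dist x w ≤ 10 * infDist x V ∧
    infDist x V < 2 * dist v w}

theorem measurableSet_spreadSet (V : Finset Plane) : MeasurableSet (spreadSet V) := by
  have : spreadSet V = ⋃ v ∈ V, ⋃ w ∈ V, ({x | dist x v ≤ 10 * infDist x V} ∩
      {x | dist x w ≤ 10 * infDist x V}) ∩ {x | infDist x V < 2 * dist v w} := by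
    ext x
    simp only [spreadSet, mem_ofPred_eq, mem_iUnion, exists_prop, mem_inter_iff, and_assoc]
  rw [this]
  have hm : Measurable fun x : Plane => infDist x (V : Set Plane) := measurable_infDist
  refine Finset.measurableSet_biUnion _ fun v _ => Finset.measurableSet_biUnion _ fun w _ => ?_
  exact ((measurableSet_le (measurable_id.dist measurable_const) (hm.const_mul 10)).inter
    (measurableSet_le (measurable_id.dist measurable_const) (hm.const_mul 10))).inter
    (measurableSet_lt hm measurable_const)

theorem lintegral_spreadSet_le {V : Finset Plane} (hV : V.Nonempty) {Ω : Set Plane}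
    (hΩ : Bornology.IsBounded Ω) :
    ∫⁻ x in Ω ∩ spreadSet V, ENNReal.ofReal (infDist x V) ^ (-2 : ℝ) ≤
      V.card * ENNReal.ofReal ((21 * 88) ^ 2 * Real.pi) := by
  obtain ⟨v₀, hv₀⟩ := id hV
  obtain ⟨T, hT⟩ := hΩ.subset_closedBall v₀
  obtain ⟨r, hr0, hr1, hr2⟩ := exists_greedy_radii hV (T / 8)
  let U : Plane → Set Plane := fun w => {x | dist x w ≤ 88 * r w ∧ r w / 21 ≤ infDist x V}
  have hsub : Ω ∩ spreadSet V ⊆ ⋃ w : V, U w := by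
    rintro x ⟨hxΩ, v, hv, w, hw, h1, h2, h3⟩
    set t := infDist x (V : Set Plane) with ht
    have ht0 : 0 ≤ t := infDist_nonneg
    have htT : t ≤ T := (infDist_le_dist_of_mem (by exact_mod_cast hv₀)).trans (hT hxΩ)
    obtain ⟨v', hv', a1, a2⟩ := hr2 (t / 8) (by linarith) (by linarith) v hv
    obtain ⟨w', hw', b1, b2⟩ := hr2 (t / 8) (by linarith) (by linarith) w hw
    have hne : v' ≠ w' := by
      rintro rfl
      have := dist_triangle_right v w v'
      linarith
    have hd : dist v' w' ≤ 21 * t := by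
      have e1 := dist_triangle4 v' v w w'
      rw [dist_comm v' v] at e1
      have e2 := dist_triangle_left v w x
      linarith
    have hm := hr1 v' hv' w' hw' hne
    have e1 := dist_triangle x v v'
    have e2 := dist_triangle x w w'
    rw [mem_iUnion]
    rcases min_le_iff.1 hm with h | h
    · exact ⟨⟨v', hv'⟩, by show dist x v' ≤ 88 * r v'; linarith,
        by show r v' / 21 ≤ infDist x V; linarith⟩
    · exact ⟨⟨w', hw'⟩, by show dist x w' ≤ 88 * r w'; linarith,
        by show r w' / 21 ≤ infDist x V; linarith⟩
  calc ∫⁻ x in Ω ∩ spreadSet V, ENNReal.ofReal (infDist x V) ^ (-2 : ℝ)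
      ≤ ∫⁻ x in ⋃ w : V, U w, ENNReal.ofReal (infDist x V) ^ (-2 : ℝ) := lintegral_mono_set hsub
    _ ≤ ∑' w : V, ∫⁻ x in U w, ENNReal.ofReal (infDist x V) ^ (-2 : ℝ) := lintegral_iUnion_le _ _
    _ ≤ ∑' _ : V, ENNReal.ofReal ((21 * 88) ^ 2 * Real.pi) := by
        refine ENNReal.tsum_le_tsum fun ⟨w, hw⟩ => ?_
        have hw0 := hr0 w hw
        calc ∫⁻ x in U w, ENNReal.ofReal (infDist x V) ^ (-2 : ℝ)
            ≤ ∫⁻ x in U w, ENNReal.ofReal (r w / 21) ^ (-2 : ℝ) := by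
              refine setLIntegral_mono measurable_const fun x hx => ?_
              exact ennreal_rpow_neg_anti (by norm_num) (ENNReal.ofReal_le_ofReal hx.2)
          _ ≤ ENNReal.ofReal (r w / 21) ^ (-2 : ℝ) * volume (closedBall w (88 * r w)) := by
              rw [setLIntegral_const]
              gcongr
              exact fun x hx => mem_closedBall.2 hx.1
          _ = ENNReal.ofReal ((21 * 88) ^ 2 * Real.pi) := by
              rw [EuclideanSpace.volume_closedBall_fin_two,
                ENNReal.ofReal_rpow_of_pos (by positivity), ← ENNReal.ofReal_pow (by positivity),
                ← ENNReal.ofReal_mul (by positivity), ← ENNReal.ofReal_mul (by positivity)]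
              congr 1
              rw [Real.rpow_neg (by positivity), Real.rpow_two]
              field_simp
    _ = _ := by
        rw [tsum_fintype, Finset.sum_const, Finset.card_univ, Fintype.card_coe, nsmul_eq_mul]

/-- A laminar family of nonempty subsets of `V` has at most `2 * #V` members. -/
theorem card_le_of_laminar {α : Type*} [DecidableEq α] (V : Finset α) :
    ∀ F : Finset (Finset α), (∀ A ∈ F, A.Nonempty ∧ A ⊆ V) →
      (∀ A ∈ F, ∀ B ∈ F, (∃ x, x ∈ A ∧ x ∈ B) → A ⊆ B ∨ B ⊆ A) → F.card ≤ 2 * V.card := by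
  induction V using Finset.induction_on with
  | empty =>
    intro F hF _
    have : F = ∅ := Finset.eq_empty_of_forall_notMem fun A hA =>
      (hF A hA).1.ne_empty (Finset.subset_empty.1 (hF A hA).2)
    simp [this]
  | insert v V hv ih =>
    intro F hF hlam
    let F₁ := F.filter fun A => v ∉ A
    let F₂ := F.filter fun A => v ∈ A
    let E := (F₂.erase {v}).image fun A => A.erase v
    have hFE : ∀ A ∈ F₁ ∪ E, A.Nonempty ∧ ∃ B ∈ F, A = B.erase v := by
      intro A hA
      rcases Finset.mem_union.1 hA with hA | hA
      · obtain ⟨hAF, hvA⟩ := Finset.mem_filter.1 hA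
        exact ⟨(hF A hAF).1, A, hAF, (Finset.erase_eq_of_notMem hvA).symm⟩
      · obtain ⟨B, hB, rfl⟩ := Finset.mem_image.1 hA
        rw [Finset.mem_erase, Finset.mem_filter] at hB
        refine ⟨?_, B, hB.2.1, rfl⟩
        rw [Finset.nonempty_iff_ne_empty, Ne, Finset.erase_eq_empty_iff]
        rintro (h | h)
        · exact (hF B hB.2.1).1.ne_empty h
        · exact hB.1 h
    have hcard : (F₁ ∪ E).card ≤ 2 * V.card := by
      refine ih _ (fun A hA => ?_) fun A hA B hB => ?_
      · obtain ⟨h, B, hB, rfl⟩ := hFE A hA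
        refine ⟨h, ?_⟩
        rw [← Finset.subset_insert_iff]
        exact (hF B hB).2
      · obtain ⟨-, A', hA', rfl⟩ := hFE A hA
        obtain ⟨-, B', hB', rfl⟩ := hFE B hB
        rintro ⟨x, hx, hx'⟩
        exact (hlam A' hA' B' hB' ⟨x, Finset.mem_of_mem_erase hx, Finset.mem_of_mem_erase hx'⟩).imp
          (Finset.erase_subset_erase v) (Finset.erase_subset_erase v)
    have hE : E.card = (F₂.erase {v}).card := by
      refine Finset.card_image_of_injOn fun A hA B hB hAB => ?_
      have hA := (Finset.mem_filter.1 (Finset.mem_of_mem_erase (Finset.mem_coe.1 hA))).2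
      have hB := (Finset.mem_filter.1 (Finset.mem_of_mem_erase (Finset.mem_coe.1 hB))).2
      rw [← Finset.insert_erase hA, ← Finset.insert_erase hB]
      exact congrArg (insert v) hAB
    have hinter : (F₁ ∩ E).card ≤ 1 := by
      have key : ∀ A ∈ F₁ ∩ E, ∀ B ∈ F₁ ∩ E, (∃ x, x ∈ A ∧ x ∈ B) → A ⊆ B := by
        intro A hA B hB hAB
        rw [Finset.mem_inter] at hA hB
        obtain ⟨B', hB', rfl⟩ := Finset.mem_image.1 hB.2
        obtain ⟨x, hx, hx'⟩ := hAB
        have hB' := Finset.mem_filter.1 (Finset.mem_of_mem_erase hB')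
        have hA1 := Finset.mem_filter.1 hA.1
        rcases hlam A hA1.1 B' hB'.1 ⟨x, hx, Finset.mem_of_mem_erase hx'⟩ with h | h
        · exact fun y hy => Finset.mem_erase.2 ⟨fun e => hA1.2 (e ▸ hy), h hy⟩
        · exact absurd (h hB'.2) hA1.2
      refine Finset.card_le_one.2 fun A hA B hB => ?_
      have hmeet : ∃ x, x ∈ A ∧ x ∈ B := by
        obtain ⟨⟨x, hx⟩, -⟩ := hFE A (Finset.mem_union_right _ (Finset.mem_inter.1 hA).2)
        obtain ⟨⟨y, hy⟩, -⟩ := hFE B (Finset.mem_union_right _ (Finset.mem_inter.1 hB).2)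
        obtain ⟨A', hA', rfl⟩ := Finset.mem_image.1 (Finset.mem_inter.1 hA).2
        obtain ⟨B', hB', rfl⟩ := Finset.mem_image.1 (Finset.mem_inter.1 hB).2
        have hA' := Finset.mem_filter.1 (Finset.mem_of_mem_erase hA')
        have hB' := Finset.mem_filter.1 (Finset.mem_of_mem_erase hB')
        rcases hlam A' hA'.1 B' hB'.1 ⟨v, hA'.2, hB'.2⟩ with h | h
        · exact ⟨x, hx, Finset.erase_subset_erase v h hx⟩
        · exact ⟨y, Finset.erase_subset_erase v h hy, hy⟩
      exact (key A hA B hB hmeet).antisymm (key B hB A hA (hmeet.imp fun x hx => hx.symm))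
    have h1 := Finset.card_union_add_card_inter F₁ E
    have h2 : F₁.card + F₂.card = F.card := by
      rw [add_comm]; exact Finset.card_filter_add_card_filter_not _
    have h3 : F₂.card - 1 ≤ (F₂.erase {v}).card := Finset.pred_card_le_card_erase
    rw [Finset.card_insert_of_notMem hv]
    omega

/-- The points of `V` that are close to `x` at the scale of the distance of `x` to `V`. -/
def clusterAt (V : Finset Plane) (x : Plane) : Finset Plane :=
  V.filter fun v => dist x v ≤ 10 * infDist x V

section Cluster

variable {V : Finset Plane} {x : Plane}

theorem mem_clusterAt {v : Plane} :
    v ∈ clusterAt V x ↔ v ∈ V ∧ dist x v ≤ 10 * infDist x V := Finset.mem_filter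

theorem dist_le_of_mem_clusterAt (hx : x ∉ spreadSet V) {v w : Plane} (hv : v ∈ clusterAt V x)
    (hw : w ∈ clusterAt V x) : 2 * dist v w ≤ infDist x V := by
  rw [mem_clusterAt] at hv hw
  by_contra! h
  exact hx ⟨v, hv.1, w, hw.1, hv.2, hw.2, h⟩

theorem exists_mem_clusterAt (hV : V.Nonempty) (x : Plane) :
    ∃ v ∈ clusterAt V x, dist x v = infDist x V := by
  obtain ⟨v, hv, h⟩ := V.finite_toSet.isCompact.exists_infDist_eq_dist (by simpa using hV) x
  refine ⟨v, mem_clusterAt.2 ⟨by exact_mod_cast hv, ?_⟩, h.symm⟩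
  have : 0 ≤ infDist x (V : Set Plane) := infDist_nonneg
  linarith

theorem infDist_le_of_mem_clusterAt {v : Plane} (hv : v ∈ clusterAt V x) :
    infDist x V ≤ dist x v :=
  infDist_le_dist_of_mem (Finset.mem_coe.2 (mem_clusterAt.1 hv).1)

theorem dist_le_infDist_of_mem_clusterAt (hx : x ∉ spreadSet V) {v : Plane}
    (hv : v ∈ clusterAt V x) : 2 * dist x v ≤ 3 * infDist x V := by
  obtain ⟨w, hw, h⟩ := exists_mem_clusterAt ⟨v, (mem_clusterAt.1 hv).1⟩ x
  have h1 := dist_le_of_mem_clusterAt hx hw hv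
  have h2 := dist_triangle x w v
  linarith

theorem clusterAt_subset_of_le {y : Plane} (hx : x ∉ spreadSet V) (hy : y ∉ spreadSet V)
    (h : ∃ v, v ∈ clusterAt V x ∧ v ∈ clusterAt V y) (hxy : infDist x V ≤ infDist y V) :
    clusterAt V x ⊆ clusterAt V y := by
  obtain ⟨v, hvx, hvy⟩ := h
  intro w hw
  refine mem_clusterAt.2 ⟨(mem_clusterAt.1 hw).1, ?_⟩
  have h1 := dist_le_of_mem_clusterAt hx hvx hw
  have h2 := dist_le_infDist_of_mem_clusterAt hy hvy
  have h3 := dist_triangle y v w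
  have h4 : 0 ≤ infDist y (V : Set Plane) := infDist_nonneg
  linarith

theorem card_clusters_le (hV : V.Nonempty) (F : Finset (Finset Plane))
    (hF : ∀ A ∈ F, ∃ x, x ∉ spreadSet V ∧ clusterAt V x = A) : F.card ≤ 2 * V.card := by
  refine card_le_of_laminar V F (fun A hA => ?_) fun A hA B hB hAB => ?_
  · obtain ⟨x, -, rfl⟩ := hF A hA
    obtain ⟨v, hv, -⟩ := exists_mem_clusterAt hV x
    exact ⟨⟨v, hv⟩, Finset.filter_subset _ _⟩
  · obtain ⟨x, hx, rfl⟩ := hF A hA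
    obtain ⟨y, hy, rfl⟩ := hF B hB
    rcases le_total (infDist x (V : Set Plane)) (infDist y V) with h | h
    · exact Or.inl (clusterAt_subset_of_le hx hy hAB h)
    · exact Or.inr (clusterAt_subset_of_le hy hx (hAB.imp fun _ h => h.symm) h)

theorem measurableSet_clusterAt_eq (V A : Finset Plane) :
    MeasurableSet {x | clusterAt V x = A} := by
  by_cases hA : A ⊆ V
  · have : {x | clusterAt V x = A} =
        ⋂ v ∈ V, {x | dist x v ≤ 10 * infDist x V ↔ v ∈ A} := by
      ext x
      simp only [mem_ofPred_eq, mem_iInter, Finset.ext_iff, mem_clusterAt]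
      refine forall_congr' fun v => ⟨fun h hv => ?_, fun h => ?_⟩
      · rw [← h]; simp [hv]
      · by_cases hv : v ∈ V
        · rw [← h hv]; simp [hv]
        · simp only [hv, false_and, false_iff]
          exact fun h => hv (hA h)
    rw [this]
    refine Finset.measurableSet_biInter _ fun v _ => ?_
    have hm : MeasurableSet {x : Plane | dist x v ≤ 10 * infDist x (V : Set Plane)} :=
      measurableSet_le (measurable_id.dist measurable_const) (measurable_infDist.const_mul 10)
    by_cases hv : v ∈ A
    · simpa [hv] using hm
    · simp only [hv, iff_false]
      exact hm.compl
  · have : {x | clusterAt V x = A} = ∅ := by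
      ext x
      simp only [mem_ofPred_eq, mem_empty_iff_false, iff_false]
      rintro rfl
      exact hA (Finset.filter_subset _ _)
    rw [this]
    exact MeasurableSet.empty

end Cluster

theorem isPreconnected_annulus (v : Plane) {r₁ : ℝ} (hr : 0 ≤ r₁) (r₂ : ℝ) :
    IsPreconnected {y : Plane | r₁ < dist y v ∧ dist y v ≤ r₂} := by
  have hrank : 1 < Module.rank ℝ Plane := by
    rw [← Module.finrank_eq_rank, finrank_euclideanSpace_fin]
    norm_num
  have e : {y : Plane | r₁ < dist y v ∧ dist y v ≤ r₂} =
      (fun q : ℝ × Plane => v + q.1 • q.2) '' (Ioc r₁ r₂ ×ˢ sphere (0 : Plane) 1) := by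
    ext y
    simp only [mem_ofPred_eq, mem_image, mem_prod, mem_sphere, dist_zero_right, Prod.exists]
    constructor
    · intro h
      have h0 : 0 < dist y v := hr.trans_lt h.1
      refine ⟨dist y v, (dist y v)⁻¹ • (y - v), ⟨h, ?_⟩, ?_⟩
      · rw [norm_smul, norm_inv, Real.norm_of_nonneg h0.le, ← dist_eq_norm, inv_mul_cancel₀ h0.ne']
      · rw [smul_smul, mul_inv_cancel₀ h0.ne', one_smul, add_sub_cancel]
    · rintro ⟨r, w, ⟨h, hw⟩, rfl⟩
      have : dist (v + r • w) v = r := by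
        rw [dist_eq_norm, add_sub_cancel_left, norm_smul, hw, mul_one,
          Real.norm_of_nonneg (hr.trans h.1.le)]
      rw [this]
      exact h
  rw [e]
  exact (isPreconnected_Ioc.prod (isPreconnected_sphere hrank 0 1)).image _ (by fun_prop)

/-- Packing bound for disjoint discs of the same size in a larger disc. -/
theorem card_mul_sq_le_of_disjoint_balls {ι : Type*} (I : Finset ι) (z : ι → Plane) {v : Plane}
    {ρ r : ℝ} (hρ : 0 < ρ) (hr : 0 < r)
    (hd : ∀ i ∈ I, ∀ j ∈ I, i ≠ j → Disjoint (ball (z i) ρ) (ball (z j) ρ))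
    (hsub : ∀ i ∈ I, ball (z i) ρ ⊆ ball v r) : I.card * ρ ^ 2 ≤ r ^ 2 := by
  have h1 : volume (⋃ i ∈ I, ball (z i) ρ) ≤ volume (ball v r) :=
    measure_mono (iUnion₂_subset hsub)
  rw [measure_biUnion_finset (fun i hi j hj hij => hd i hi j hj hij) fun i _ => measurableSet_ball]
    at h1
  simp only [EuclideanSpace.volume_ball_fin_two, Finset.sum_const, nsmul_eq_mul] at h1
  rw [← mul_assoc, ENNReal.mul_le_mul_iff_left] at h1
  · rw [← ENNReal.ofReal_pow hρ.le, ← ENNReal.ofReal_pow hr.le, ← ENNReal.ofReal_natCast,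
      ← ENNReal.ofReal_mul (by positivity)] at h1
    exact (ENNReal.ofReal_le_ofReal_iff (by positivity)).1 h1
  · simp [Real.pi_pos]
  · simp

/-- The points of `Ω` off `V` and off the spread set having a given cluster. -/
def clusterCell (V : Finset Plane) (Ω : Set Plane) (A : Finset Plane) : Set Plane :=
  {x | x ∈ Ω ∧ x ∉ spreadSet V ∧ 0 < infDist x V ∧ clusterAt V x = A}

/-- Only boundedly many tiles meet a given cluster cell. -/
theorem IsTiling.card_meeting_clusterCell_le {κ : ℝ} {K : ℕ} {Ω : Set Plane} {V : Finset Plane}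
    {n : ℕ} {R : Fin n → Set Plane} (hT : IsTiling κ K Ω V R) (hκ : 0 < κ) (hκ1 : κ ≤ 1)
    (hV : V.Nonempty) (hΩ : Bornology.IsBounded Ω) (A : Finset Plane) (I : Finset (Fin n))
    (hI : ∀ i ∈ I, (R i ∩ clusterCell V Ω A).Nonempty) : (I.card : ℝ) ≤ (24 / κ) ^ 2 + 1 := by
  rcases (clusterCell V Ω A).eq_empty_or_nonempty with h0 | ⟨x₁, hx₁⟩
  · have : I = ∅ := Finset.eq_empty_of_forall_notMem fun i hi => by
      have := hI i hi
      simp [h0] at this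
    subst this
    simp only [Finset.card_empty, Nat.cast_zero]
    positivity
  obtain ⟨v, hvA, -⟩ := exists_mem_clusterAt hV x₁
  rw [hx₁.2.2.2] at hvA
  obtain ⟨x₀, hx₀, hmax⟩ : ∃ x₀ ∈ clusterCell V Ω A, ∀ x ∈ clusterCell V Ω A,
      infDist x V ≤ 2 * infDist x₀ V := by
    obtain ⟨T, hT⟩ := hΩ.subset_closedBall v
    have hvV : v ∈ V := by
      rw [← hx₁.2.2.2, mem_clusterAt] at hvA
      exact hvA.1
    let D : Set ℝ := (fun x => infDist x (V : Set Plane)) '' clusterCell V Ω A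
    have hb : BddAbove D := by
      refine ⟨T, ?_⟩
      rintro _ ⟨x, hx, rfl⟩
      exact (infDist_le_dist_of_mem (Finset.mem_coe.2 hvV)).trans (hT hx.1)
    have hpos : 0 < sSup D := hx₁.2.2.1.trans_le (le_csSup hb ⟨x₁, hx₁, rfl⟩)
    obtain ⟨_, ⟨x₀, hx₀, rfl⟩, h⟩ := exists_lt_of_lt_csSup (s := D) ⟨_, x₁, hx₁, rfl⟩
      (half_lt_self hpos)
    refine ⟨x₀, hx₀, fun x hx => ?_⟩
    have := le_csSup hb ⟨x, hx, rfl⟩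
    dsimp only at h this
    linarith
  set t := infDist x₀ (V : Set Plane)
  have ht : 0 < t := hx₀.2.2.1
  have hmemA : ∀ x ∈ clusterCell V Ω A, ∀ w, w ∈ A ↔ w ∈ clusterAt V x := fun x hx w => by
    rw [hx.2.2.2]
  obtain ⟨w, hwA, hw⟩ := A.exists_max_image (fun w => dist w v) ⟨v, hvA⟩
  let Ann : Set Plane := {y | dist w v < dist y v ∧ dist y v ≤ 4 * t}
  have hAnn : IsPreconnected Ann := isPreconnected_annulus v dist_nonneg _
  have hcell : clusterCell V Ω A ⊆ Ann := by
    intro x hx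
    have h1 := dist_le_of_mem_clusterAt hx.2.1 ((hmemA x hx w).1 hwA) ((hmemA x hx v).1 hvA)
    have h2 := infDist_le_of_mem_clusterAt ((hmemA x hx v).1 hvA)
    have h3 := dist_le_infDist_of_mem_clusterAt hx.2.1 ((hmemA x hx v).1 hvA)
    have h4 := hmax x hx
    have h5 := hx.2.2.1
    constructor <;> linarith
  have hlong : ∀ a ∈ V, ∀ y ∈ Ann, a ∉ A → t ≤ dist a y := by
    intro a ha y hy haA
    have h1 : 10 * t < dist x₀ a := by
      by_contra! h
      exact haA ((hmemA x₀ hx₀ a).2 (mem_clusterAt.2 ⟨ha, h⟩))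
    have h2 := dist_le_infDist_of_mem_clusterAt hx₀.2.1 ((hmemA x₀ hx₀ v).1 hvA)
    have h3 := dist_triangle4 x₀ v y a
    have h4 := hy.2
    rw [dist_comm a y]
    rw [dist_comm v y] at h3
    linarith
  let I₁ := I.filter fun i => (frontier (R i) ∩ Ann).Nonempty
  let I₂ := I.filter fun i => ¬ (frontier (R i) ∩ Ann).Nonempty
  have hI₂ : I₂.card ≤ 1 := by
    have key : ∀ i ∈ I₂, Ann ⊆ interior (R i) := by
      intro i hi
      obtain ⟨hiI, hfr⟩ := Finset.mem_filter.1 hi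
      have hin : ∀ y ∈ Ann, y ∈ R i → y ∈ interior (R i) := fun y hy hyR => by
        by_contra hcon
        exact hfr ⟨y, ⟨subset_closure hyR, hcon⟩, hy⟩
      obtain ⟨x, hxR, hx⟩ := hI i hiI
      refine hAnn.subset_of_closure_inter_subset isOpen_interior
        ⟨x, hcell hx, hin x (hcell hx) hxR⟩ fun y hy => hin y hy.2 ?_
      exact closure_minimal interior_subset (hT.isClosed i) hy.1
    refine Finset.card_le_one.2 fun i hi j hj => ?_
    by_contra hij
    exact hT.interior_inter_eq_empty hκ hκ1 hij (key i hi (hcell hx₀))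
      (interior_subset (key j hj (hcell hx₀)))
  have hI₁ : ∀ i ∈ I₁, ∃ z, ball z (κ * t / 4) ⊆ R i ∧ ball z (κ * t / 4) ⊆ ball v (6 * t) := by
    intro i hi
    obtain ⟨-, y, hyf, hy⟩ := Finset.mem_filter.1 hi
    obtain ⟨a, ha, b, hb, hyab, hH⟩ := hT.exists_edge hyf
    have hℓ : t ≤ dist a b := by
      have hsum := dist_add_dist_of_mem_segment hyab
      by_cases haA : a ∈ A
      · by_cases hbA : b ∈ A
        · exfalso
          have := (convex_closedBall v (dist w v)).segment_subset (mem_closedBall.2 (hw a haA))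
            (mem_closedBall.2 (hw b hbA)) hyab
          exact absurd (mem_closedBall.1 this) (not_le.2 hy.1)
        · have := hlong b hb y hy hbA
          rw [dist_comm] at this
          linarith [dist_nonneg (x := a) (y := y)]
      · have := hlong a ha y hy haA
        linarith [dist_nonneg (x := y) (y := b)]
    obtain ⟨z, hz, hzb⟩ := hH.exists_ball hκ hκ1 hyab ht hℓ
    refine ⟨z, hzb, ball_subset_ball' ?_⟩
    have h1 := dist_triangle z y v
    have h2 := hy.2
    nlinarith
  choose! z hz1 hz2 using hI₁
  have hpack := card_mul_sq_le_of_disjoint_balls I₁ z (v := v) (ρ := κ * t / 4) (r := 6 * t)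
    (by positivity) (by positivity) (fun i hi j hj hij => by
      rw [Set.disjoint_left]
      intro y hyi hyj
      exact hT.interior_inter_eq_empty hκ hκ1 hij
        (interior_maximal (hz1 i hi) isOpen_ball hyi) (hz1 j hj hyj)) hz2
  have hI₁' : (I₁.card : ℝ) ≤ (24 / κ) ^ 2 := by
    rw [div_pow, le_div_iff₀ (by positivity)]
    have : (I₁.card : ℝ) * κ ^ 2 * t ^ 2 ≤ 24 ^ 2 * t ^ 2 := by nlinarith
    exact le_of_mul_le_mul_right this (by positivity)
  have hsum : I₁.card + I₂.card = I.card := Finset.card_filter_add_card_filter_not _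
  have : (I.card : ℝ) = I₁.card + I₂.card := by exact_mod_cast hsum.symm
  have h2 : (I₂.card : ℝ) ≤ 1 := by exact_mod_cast hI₂
  linarith

theorem measurableSet_clusterCell (V : Finset Plane) {Ω : Set Plane} (hΩ : MeasurableSet Ω)
    (A : Finset Plane) : MeasurableSet (clusterCell V Ω A) :=
  hΩ.inter ((measurableSet_spreadSet V).compl.inter
    ((measurableSet_lt measurable_const measurable_infDist).inter (measurableSet_clusterAt_eq V A)))

theorem setLIntegral_spreadSet_weight_le {θ : ℝ} (hθ : 0 < θ) (hθ1 : θ < 1) {V : Finset Plane}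
    (hV : V.Nonempty) {Ω : Set Plane} (hΩ : Bornology.IsBounded Ω) {u : Plane → ℝ≥0∞}
    (hu : Measurable u) :
    ∫⁻ x in Ω ∩ spreadSet V, u x * ENNReal.ofReal (infDist x V) ^ (-θ) ≤
      (∫⁻ x in Ω, u x ^ (1 - θ / 2)⁻¹) ^ (1 - θ / 2) *
        (V.card * ENNReal.ofReal ((21 * 88) ^ 2 * Real.pi)) ^ (θ / 2) := by
  have hpq : ((1 - θ / 2)⁻¹).HolderConjugate (θ / 2)⁻¹ :=
    Real.HolderConjugate.inv_inv (by linarith) (by linarith) (by ring)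
  have hw : Measurable fun x : Plane => ENNReal.ofReal (infDist x V) ^ (-θ) :=
    (measurable_infDist.ennreal_ofReal).pow_const _
  refine (ENNReal.lintegral_mul_le_Lp_mul_Lq (volume.restrict (Ω ∩ spreadSet V)) hpq
    hu.aemeasurable hw.aemeasurable).trans ?_
  rw [one_div, one_div, inv_inv, inv_inv]
  refine mul_le_mul' (ENNReal.rpow_le_rpow (lintegral_mono_set inter_subset_left) (by linarith))
    (ENNReal.rpow_le_rpow ?_ (by linarith))
  have e : ∀ x : Plane, (ENNReal.ofReal (infDist x V) ^ (-θ)) ^ (θ / 2)⁻¹ =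
      ENNReal.ofReal (infDist x V) ^ (-2 : ℝ) := fun x => by
    rw [← ENNReal.rpow_mul]
    congr 1
    field_simp
  simp_rw [e]
  exact lintegral_spreadSet_le hV hΩ

/-- The weighted integral of a function that is constant on a piece of a cluster cell. -/
theorem exists_setLIntegral_cell_weight_le {θ : ℝ} (hθ : 0 < θ) (hθ1 : θ < 1) :
    ∃ C : ℝ≥0∞, C ≠ ⊤ ∧ ∀ (V A : Finset Plane) (Ω Z : Set Plane) (u : Plane → ℝ≥0∞) (d : ℝ≥0∞),
      V.Nonempty → Bornology.IsBounded Ω → MeasurableSet Z → Z ⊆ clusterCell V Ω A →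
      (∀ x ∈ Z, u x = d) →
      ∫⁻ x in Z, u x * ENNReal.ofReal (infDist x V) ^ (-θ) ≤
        C * (∫⁻ x in Z, u x ^ (1 - θ / 2)⁻¹) ^ (1 - θ / 2) := by
  obtain ⟨C, hC, H⟩ := exists_setLIntegral_dist_rpow_le hθ hθ1
  set c : ℝ≥0∞ := (2⁻¹ : ℝ≥0∞) ^ (-θ) with hc
  have hcT : c ≠ ⊤ := ENNReal.rpow_ne_top_of_ne_zero (by simp) (by simp)
  refine ⟨c * C, ENNReal.mul_ne_top hcT hC, fun V A Ω Z u d hV hΩ hZ hZA hu => ?_⟩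
  rcases Z.eq_empty_or_nonempty with rfl | ⟨x₀, hx₀⟩
  · simp
  obtain ⟨v, hv, -⟩ := exists_mem_clusterAt hV x₀
  rw [(hZA hx₀).2.2.2] at hv
  have hZT : volume Z ≠ ⊤ :=
    ((measure_mono fun x hx => (hZA hx).1).trans_lt hΩ.measure_lt_top).ne
  have hwd : ∀ x ∈ Z, ENNReal.ofReal (infDist x V) ^ (-θ) ≤
      c * ENNReal.ofReal (dist x v) ^ (-θ) := by
    intro x hx
    have hx' := hZA hx
    have h := dist_le_infDist_of_mem_clusterAt hx'.2.1 (v := v) (by rw [hx'.2.2.2]; exact hv)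
    rw [hc, ← ENNReal.mul_rpow_of_ne_top (by simp) ENNReal.ofReal_ne_top]
    refine ennreal_rpow_neg_anti hθ.le ?_
    rw [show (2⁻¹ : ℝ≥0∞) = ENNReal.ofReal 2⁻¹ by
      rw [ENNReal.ofReal_inv_of_pos (by norm_num)]; simp, ← ENNReal.ofReal_mul (by norm_num)]
    apply ENNReal.ofReal_le_ofReal
    linarith [hx'.2.2.1]
  have hw : Measurable fun x : Plane => ENNReal.ofReal (dist x v) ^ (-θ) :=
    ((measurable_id.dist measurable_const).ennreal_ofReal).pow_const _
  calc ∫⁻ x in Z, u x * ENNReal.ofReal (infDist x V) ^ (-θ)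
      ≤ ∫⁻ x in Z, d * c * ENNReal.ofReal (dist x v) ^ (-θ) := by
        refine setLIntegral_mono (hw.const_mul _) fun x hx => ?_
        rw [hu x hx, mul_assoc]
        gcongr
        exact hwd x hx
    _ = d * c * ∫⁻ x in Z, ENNReal.ofReal (dist x v) ^ (-θ) := lintegral_const_mul _ hw
    _ ≤ d * c * (C * volume Z ^ (1 - θ / 2)) := by gcongr; exact H v Z hZT
    _ = c * C * (∫⁻ x in Z, u x ^ (1 - θ / 2)⁻¹) ^ (1 - θ / 2) := by
        have : ∫⁻ x in Z, u x ^ (1 - θ / 2)⁻¹ = ∫⁻ x in Z, d ^ (1 - θ / 2)⁻¹ :=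
          setLIntegral_congr_fun hZ fun x hx => by simp only [hu x hx]
        rw [this, setLIntegral_const, ENNReal.mul_rpow_of_nonneg _ _ (by linarith),
          ← ENNReal.rpow_mul, inv_mul_cancel₀ (by linarith), ENNReal.rpow_one]
        ring

theorem ae_mem_interior_tile {κ : ℝ} {K : ℕ} {Ω : Set Plane} {V : Finset Plane} {n : ℕ}
    {R : Fin n → Set Plane} (hT : IsTiling κ K Ω V R) :
    ∀ᵐ x, x ∈ Ω → ∃ i, x ∈ interior (R i) := by
  have h : ∀ᵐ x, x ∉ ⋃ j, frontier (R j) :=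
    measure_eq_zero_iff_ae_notMem.1 (measure_iUnion_null fun j => hT.null_frontier j)
  filter_upwards [h] with x hx hxΩ
  rw [← hT.iUnion_eq, mem_iUnion] at hxΩ
  obtain ⟨j, hj⟩ := hxΩ
  refine ⟨j, ?_⟩
  by_contra hcon
  exact hx (mem_iUnion.2 ⟨j, subset_closure hj, hcon⟩)

/-- A function that is constant on the common refinement of two tilings, integrated against a
power of the distance to the vertices. -/
theorem exists_lintegral_weight_le {κ θ : ℝ} (hκ : 0 < κ) (hκ1 : κ ≤ 1) (hθ : 0 < θ)
    (hθ1 : θ < 1) :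
    ∃ C : ℝ≥0∞, C ≠ ⊤ ∧ ∀ (K n m : ℕ) (Ω : Set Plane) (V : Finset Plane) (R : Fin n → Set Plane)
      (Q : Fin m → Set Plane) (u : Plane → ℝ≥0∞) (d : Fin n → Fin m → ℝ≥0∞),
      IsTiling κ K Ω V R → IsTiling κ K Ω V Q → V.Nonempty → Bornology.IsBounded Ω →
      MeasurableSet Ω → Measurable u →
      (∀ i j, ∀ x ∈ interior (R i), x ∈ interior (Q j) → u x = d i j) →
      ∫⁻ x in Ω, u x * ENNReal.ofReal (infDist x V) ^ (-θ) ≤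
        C * (V.card : ℝ≥0∞) ^ (θ / 2) * (∫⁻ x in Ω, u x ^ (1 - θ / 2)⁻¹) ^ (1 - θ / 2) := by
  obtain ⟨C, hC, H⟩ := exists_setLIntegral_cell_weight_le hθ hθ1
  set M : ℝ := (24 / κ) ^ 2 + 1 with hM
  have hM0 : 0 ≤ M := by positivity
  have hpq : ((1 - θ / 2)⁻¹).HolderConjugate (θ / 2)⁻¹ :=
    Real.HolderConjugate.inv_inv (by linarith) (by linarith) (by ring)
  refine ⟨ENNReal.ofReal ((21 * 88) ^ 2 * Real.pi) ^ (θ / 2) +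
    C * ENNReal.ofReal (2 * M ^ 2) ^ (θ / 2), ?_, ?_⟩
  · exact ENNReal.add_ne_top.2 ⟨ENNReal.rpow_ne_top_of_nonneg (by linarith) ENNReal.ofReal_ne_top,
      ENNReal.mul_ne_top hC (ENNReal.rpow_ne_top_of_nonneg (by linarith) ENNReal.ofReal_ne_top)⟩
  intro K n m Ω V R Q u d hR hQ hV hΩ hΩm hu hud
  let w : Plane → ℝ≥0∞ := fun x => ENNReal.ofReal (infDist x V) ^ (-θ)
  let q : ℝ := (1 - θ / 2)⁻¹
  let F : Finset (Finset Plane) := V.powerset.filter fun A => (clusterCell V Ω A).Nonempty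
  let I : Finset Plane → Finset (Fin n) := fun A =>
    Finset.univ.filter fun i => (R i ∩ clusterCell V Ω A).Nonempty
  let J : Finset Plane → Finset (Fin m) := fun A =>
    Finset.univ.filter fun j => (Q j ∩ clusterCell V Ω A).Nonempty
  let P : Finset (Σ _ : Finset Plane, Fin n × Fin m) := F.sigma fun A => I A ×ˢ J A
  let Z : (Σ _ : Finset Plane, Fin n × Fin m) → Set Plane := fun k =>
    clusterCell V Ω k.1 ∩ (interior (R k.2.1) ∩ interior (Q k.2.2))
  have hZm : ∀ k, MeasurableSet (Z k) := fun k =>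
    (measurableSet_clusterCell V hΩm _).inter
      (isOpen_interior.measurableSet.inter isOpen_interior.measurableSet)
  have hZd : ∀ k ∈ P, ∀ l ∈ P, k ≠ l → Disjoint (Z k) (Z l) := by
    rintro ⟨A, i, j⟩ - ⟨B, i', j'⟩ - hne
    rw [Set.disjoint_left]
    rintro x ⟨h1, h2, h3⟩ ⟨g1, g2, g3⟩
    apply hne
    have e1 : A = B := h1.2.2.2.symm.trans g1.2.2.2
    have e2 : i = i' := by
      by_contra h
      exact hR.interior_inter_eq_empty hκ hκ1 h h2 (interior_subset g2)
    have e3 : j = j' := by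
      by_contra h
      exact hQ.interior_inter_eq_empty hκ hκ1 h h3 (interior_subset g3)
    subst e1 e2 e3
    rfl
  have hcard : (P.card : ℝ≥0∞) ≤ V.card * ENNReal.ofReal (2 * M ^ 2) := by
    have h1 : (F.card : ℝ) ≤ 2 * V.card := by
      have := card_clusters_le hV F fun A hA => by
        obtain ⟨x, hx⟩ := (Finset.mem_filter.1 hA).2
        exact ⟨x, hx.2.1, hx.2.2.2⟩
      exact_mod_cast this
    have h2 : (P.card : ℝ) ≤ V.card * (2 * M ^ 2) := by
      calc (P.card : ℝ) = ∑ A ∈ F, ((I A).card : ℝ) * (J A).card := by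
            simp only [P, Finset.card_sigma, Finset.card_product]
            push_cast
            rfl
        _ ≤ ∑ A ∈ F, M * M := by
            refine Finset.sum_le_sum fun A _ => mul_le_mul ?_ ?_ (by positivity) hM0
            · exact hR.card_meeting_clusterCell_le hκ hκ1 hV hΩ A _ fun i hi =>
                (Finset.mem_filter.1 hi).2
            · exact hQ.card_meeting_clusterCell_le hκ hκ1 hV hΩ A _ fun i hi =>
                (Finset.mem_filter.1 hi).2
        _ = F.card * (M * M) := by rw [Finset.sum_const, nsmul_eq_mul]
        _ ≤ 2 * V.card * (M * M) := by gcongr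
        _ = _ := by ring
    rw [← ENNReal.ofReal_natCast, ← ENNReal.ofReal_natCast, ← ENNReal.ofReal_mul (by positivity)]
    exact ENNReal.ofReal_le_ofReal h2
  have hcell : ∫⁻ x in Ω \ spreadSet V, u x * w x ≤
      C * ((∫⁻ x in Ω, u x ^ q) ^ (1 - θ / 2) * (P.card : ℝ≥0∞) ^ (θ / 2)) := by
    have hV0 : ∀ᵐ x : Plane, x ∉ (V : Set Plane) :=
      measure_eq_zero_iff_ae_notMem.1 (V.finite_toSet.measure_zero volume)
    have hcov : (Ω \ spreadSet V : Set Plane) ≤ᵐ[volume] ⋃ k ∈ P, Z k := by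
      filter_upwards [hV0, ae_mem_interior_tile hR, ae_mem_interior_tile hQ] with x h1 h2 h3 hx
      obtain ⟨i, hi⟩ := h2 hx.1
      obtain ⟨j, hj⟩ := h3 hx.1
      have hxc : x ∈ clusterCell V Ω (clusterAt V x) := ⟨hx.1, hx.2,
        (V.finite_toSet.isClosed.notMem_iff_infDist_pos (by simpa using hV)).1 h1, rfl⟩
      refine mem_iUnion₂.2 ⟨⟨clusterAt V x, i, j⟩, ?_, hxc, hi, hj⟩
      simp only [P, F, I, J, Finset.mem_sigma, Finset.mem_filter, Finset.mem_powerset,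
        Finset.mem_product, Finset.mem_univ, true_and]
      exact ⟨⟨Finset.filter_subset _ _, x, hxc⟩, ⟨x, interior_subset hi, hxc⟩,
        ⟨x, interior_subset hj, hxc⟩⟩
    calc ∫⁻ x in Ω \ spreadSet V, u x * w x ≤ ∫⁻ x in ⋃ k ∈ P, Z k, u x * w x :=
          lintegral_mono' (Measure.restrict_mono_ae hcov) le_rfl
      _ = ∑ k ∈ P, ∫⁻ x in Z k, u x * w x :=
          lintegral_biUnion_finset (fun k hk l hl hkl => hZd k hk l hl hkl) (fun k _ => hZm k) _
      _ ≤ ∑ k ∈ P, C * (∫⁻ x in Z k, u x ^ q) ^ (1 - θ / 2) := by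
          refine Finset.sum_le_sum fun k _ => ?_
          exact H V k.1 Ω (Z k) u (d k.2.1 k.2.2) hV hΩ (hZm k) inter_subset_left
            fun x hx => hud _ _ x hx.2.1 hx.2.2
      _ = C * ∑ k ∈ P, (∫⁻ x in Z k, u x ^ q) ^ (1 - θ / 2) * 1 := by
          rw [Finset.mul_sum]; simp
      _ ≤ C * ((∫⁻ x in Ω, u x ^ q) ^ (1 - θ / 2) * (P.card : ℝ≥0∞) ^ (θ / 2)) := by
          gcongr
          refine (ENNReal.inner_le_Lp_mul_Lq P _ _ hpq).trans ?_
          rw [one_div, one_div, inv_inv, inv_inv]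
          simp only [← ENNReal.rpow_mul, ENNReal.one_rpow, Finset.sum_const, nsmul_eq_mul, mul_one]
          rw [mul_inv_cancel₀ (by linarith)]
          simp only [ENNReal.rpow_one]
          gcongr
          · linarith
          rw [← lintegral_biUnion_finset (fun k hk l hl hkl => hZd k hk l hl hkl)
            (fun k _ => hZm k)]
          exact lintegral_mono_set (iUnion₂_subset fun k _ x hx => hx.1.1)
  calc ∫⁻ x in Ω, u x * w x
      = (∫⁻ x in Ω ∩ spreadSet V, u x * w x) + ∫⁻ x in Ω \ spreadSet V, u x * w x :=
        (lintegral_inter_add_sdiff _ _ (measurableSet_spreadSet V)).symm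
    _ ≤ _ := add_le_add (setLIntegral_spreadSet_weight_le hθ hθ1 hV hΩ hu) hcell
    _ ≤ (∫⁻ x in Ω, u x ^ q) ^ (1 - θ / 2) *
          (V.card * ENNReal.ofReal ((21 * 88) ^ 2 * Real.pi)) ^ (θ / 2) +
        C * ((∫⁻ x in Ω, u x ^ q) ^ (1 - θ / 2) *
          (V.card * ENNReal.ofReal (2 * M ^ 2)) ^ (θ / 2)) := by
        gcongr
    _ = _ := by
        rw [ENNReal.mul_rpow_of_nonneg _ _ (by linarith),
          ENNReal.mul_rpow_of_nonneg _ _ (by linarith)]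
        ring

theorem lpNormE_rpow {p : ℝ} (hp : 0 < p) (Ω : Set Plane) (f : Plane → ℝ) :
    lpNormE p Ω f ^ p = ∫⁻ x in Ω, ‖f x‖ₑ ^ p := by
  unfold lpNormE
  rw [eLpNorm_eq_lintegral_rpow_enorm_toReal (by simpa using hp) ofReal_ne_top,
    ENNReal.toReal_ofReal hp.le, ← ENNReal.rpow_mul, one_div, inv_mul_cancel₀ hp.ne',
    ENNReal.rpow_one]

theorem exists_lintegral_min_le {θ : ℝ} (hθ : 0 < θ) (hθ1 : θ < 1) :
    ∃ D : ℝ≥0∞, D ≠ ⊤ ∧ ∀ ρ : ℝ,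
      ∫⁻ t in Ioi (0 : ℝ), ENNReal.ofReal (t ^ (-θ - 1)) *
        min 1 (ENNReal.ofReal t / ENNReal.ofReal ρ) ≤ D * ENNReal.ofReal ρ ^ (-θ) := by
  refine ⟨ENNReal.ofReal (1 / (1 - θ) + 1 / θ), ofReal_ne_top, fun ρ => ?_⟩
  have h1θ : 0 < 1 - θ := by linarith
  rcases le_or_gt ρ 0 with hρ | hρ
  · rw [ofReal_of_nonpos hρ, ENNReal.zero_rpow_of_neg (by linarith), ENNReal.mul_top]
    · exact le_top
    · rw [Ne, ENNReal.ofReal_eq_zero, not_le]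
      positivity
  rw [← Ioc_union_Ioi_eq_Ioi hρ.le]
  refine (lintegral_union_le _ _ _).trans ?_
  have hnear : ∫⁻ t in Ioc 0 ρ, ENNReal.ofReal (t ^ (-θ - 1)) *
      min 1 (ENNReal.ofReal t / ENNReal.ofReal ρ) ≤ ENNReal.ofReal (ρ ^ (-θ) * (1 / (1 - θ))) := by
    have hint : IntegrableOn (fun t : ℝ => t ^ (-θ) / ρ) (Ioc 0 ρ) := by
      rw [← intervalIntegrable_iff_integrableOn_Ioc_of_le hρ.le]
      exact (intervalIntegral.intervalIntegrable_rpow' (by linarith)).div_const ρ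
    calc _ ≤ ∫⁻ t in Ioc 0 ρ, ENNReal.ofReal (t ^ (-θ) / ρ) := by
          refine setLIntegral_mono (by fun_prop) fun t ht => ?_
          refine (mul_le_mul_right (min_le_right _ _) _).trans_eq ?_
          rw [← ENNReal.ofReal_div_of_pos hρ, ← ENNReal.ofReal_mul (by positivity [ht.1]),
            Real.rpow_sub_one ht.1.ne']
          congr 1
          field_simp [ht.1.ne']
      _ = ENNReal.ofReal (∫ t in Ioc 0 ρ, t ^ (-θ) / ρ) := by
          rw [ofReal_integral_eq_lintegral_ofReal hint]
          filter_upwards [ae_restrict_mem measurableSet_Ioc] with t ht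
          have := ht.1
          positivity
      _ = _ := by
          rw [← intervalIntegral.integral_of_le hρ.le, intervalIntegral.integral_div,
            integral_rpow (Or.inl (by linarith)), Real.zero_rpow (by linarith),
            Real.rpow_add_one hρ.ne']
          congr 1
          rw [show -θ + 1 = 1 - θ by ring]
          field_simp
          ring
  have hfar : ∫⁻ t in Ioi ρ, ENNReal.ofReal (t ^ (-θ - 1)) *
      min 1 (ENNReal.ofReal t / ENNReal.ofReal ρ) ≤ ENNReal.ofReal (ρ ^ (-θ) * (1 / θ)) := by
    calc _ ≤ ∫⁻ t in Ioi ρ, ENNReal.ofReal (t ^ (-θ - 1)) :=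
          lintegral_mono fun t => mul_le_of_le_one_right' (min_le_left _ _)
      _ = ENNReal.ofReal (∫ t in Ioi ρ, t ^ (-θ - 1)) := by
          rw [ofReal_integral_eq_lintegral_ofReal
            (integrableOn_Ioi_rpow_of_lt (by linarith) hρ)]
          filter_upwards [ae_restrict_mem measurableSet_Ioi] with t ht
          have : 0 < t := hρ.trans ht
          positivity
      _ = _ := by
          rw [integral_Ioi_rpow_of_lt (by linarith) hρ]
          congr 1
          rw [show -θ - 1 + 1 = -θ by ring]
          field_simp
  refine (add_le_add hnear hfar).trans_eq ?_
  rw [← ENNReal.ofReal_add (by positivity) (by positivity), ← mul_add,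
    ENNReal.ofReal_mul (by positivity), ENNReal.ofReal_rpow_of_pos hρ, mul_comm]

theorem IsTiling.modulus_rpow_le {κ : ℝ} {K n : ℕ} {Ω : Set Plane} {V : Finset Plane}
    {R : Fin n → Set Plane} (hT : IsTiling κ K Ω V R) (hκ : 0 < κ) (hκ1 : κ ≤ 1)
    (hΩ : IsClosed Ω) {f g : Plane → ℝ} (hf : Measurable f) (hg : Measurable g) {c : Fin n → ℝ}
    (hfc : ∀ j, ∀ x ∈ interior (R j), f x = c j) {τ : ℝ} (hτ : 0 < τ) (hτ1 : τ ≤ 1) (t : ℝ) :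
    modulus Ω 1 τ f t ^ τ ≤ modulus Ω 1 τ g t ^ τ +
      ENNReal.ofReal (18 / κ) * ∫⁻ x in Ω, ‖f x - g x‖ₑ ^ τ * jumpWeight V t x := by
  rw [← ENNReal.le_rpow_inv_iff hτ]
  refine iSup₂_le fun h ht => ?_
  rw [ENNReal.le_rpow_inv_iff hτ, lpNormE_rpow hτ]
  refine (hT.lintegral_deltah_le hκ hκ1 hΩ hf hg hfc hτ hτ1 h).trans (add_le_add ?_ ?_)
  · rw [← lpNormE_rpow hτ]
    exact ENNReal.rpow_le_rpow
      (le_iSup₂ (f := fun h (_ : ‖h‖ ≤ t) => lpNormE τ Ω (deltah Ω 1 h g)) h ht) hτ.le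
  · gcongr with x
    exact jumpWeight_mono V ht x

theorem besovSeminorm_rpow {s τ : ℝ} (hτ : 0 < τ) (Ω : Set Plane) (k : ℕ) (f : Plane → ℝ) :
    besovSeminorm Ω k s τ f ^ τ =
      ∫⁻ t in Ioi (0 : ℝ), ENNReal.ofReal (t ^ (-(s * τ) - 1)) * modulus Ω k τ f t ^ τ := by
  unfold besovSeminorm
  rw [← ENNReal.rpow_mul, one_div, inv_mul_cancel₀ hτ.ne', ENNReal.rpow_one]
  refine setLIntegral_congr_fun measurableSet_Ioi fun t ht => ?_
  have ht : 0 < t := ht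
  rw [ENNReal.mul_rpow_of_nonneg _ _ hτ.le, ENNReal.ofReal_rpow_of_pos (by positivity),
    ← Real.rpow_mul ht.le, neg_mul, Real.rpow_sub_one ht.ne', ENNReal.ofReal_div_of_pos ht,
    ENNReal.mul_div_right_comm]

theorem measurable_jumpWeight_uncurry (V : Finset Plane) :
    Measurable fun z : ℝ × Plane => jumpWeight V z.1 z.2 := by
  unfold jumpWeight
  have : Measurable fun z : ℝ × Plane => infDist z.2 (V : Set Plane) :=
    (continuous_infDist_pt _).measurable.comp measurable_snd
  fun_prop

theorem exists_besovSeminorm_rpow_le {κ s τ : ℝ} (hκ : 0 < κ) (hκ1 : κ ≤ 1) (hτ : 0 < τ)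
    (hτ1 : τ ≤ 1) (hθ : 0 < s * τ) (hθ1 : s * τ < 1) :
    ∃ C : ℝ≥0∞, C ≠ ⊤ ∧ ∀ (K n : ℕ) (Ω : Set Plane) (V : Finset Plane) (R : Fin n → Set Plane)
      (f g : Plane → ℝ) (c : Fin n → ℝ), IsTiling κ K Ω V R → IsClosed Ω → Measurable f →
      Measurable g → (∀ j, ∀ x ∈ interior (R j), f x = c j) →
      besovSeminorm Ω 1 s τ f ^ τ ≤ besovSeminorm Ω 1 s τ g ^ τ +
        C * ∫⁻ x in Ω, ‖f x - g x‖ₑ ^ τ * ENNReal.ofReal (infDist x V) ^ (-(s * τ)) := by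
  obtain ⟨D, hD, hDρ⟩ := exists_lintegral_min_le hθ hθ1
  refine ⟨ENNReal.ofReal (18 / κ) * D, mul_ne_top ofReal_ne_top hD, ?_⟩
  intro K n Ω V R f g c hT hΩ hf hg hfc
  have hw : Measurable fun t : ℝ => ENNReal.ofReal (t ^ (-(s * τ) - 1)) := by fun_prop
  have hu : Measurable fun x => ‖f x - g x‖ₑ ^ τ := by fun_prop
  have hJ := measurable_jumpWeight_uncurry V
  have hF : Measurable fun z : ℝ × Plane => ENNReal.ofReal (z.1 ^ (-(s * τ) - 1)) *
      (‖f z.2 - g z.2‖ₑ ^ τ * jumpWeight V z.1 z.2) :=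
    (hw.comp measurable_fst).mul ((hu.comp measurable_snd).mul hJ)
  have hE : ∫⁻ t in Ioi (0 : ℝ), ∫⁻ x in Ω, ENNReal.ofReal (t ^ (-(s * τ) - 1)) *
      (‖f x - g x‖ₑ ^ τ * jumpWeight V t x) ≤
      D * ∫⁻ x in Ω, ‖f x - g x‖ₑ ^ τ * ENNReal.ofReal (infDist x V) ^ (-(s * τ)) := by
    rw [lintegral_lintegral_swap hF.aemeasurable, ← lintegral_const_mul' _ _ hD]
    refine lintegral_mono fun x => ?_
    simp_rw [mul_left_comm _ (‖f x - g x‖ₑ ^ τ)]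
    rw [lintegral_const_mul' _ _ (ENNReal.rpow_ne_top_of_nonneg hτ.le enorm_ne_top)]
    exact mul_le_mul_right (hDρ _) _
  rw [besovSeminorm_rpow hτ, besovSeminorm_rpow hτ]
  calc _ ≤ ∫⁻ t in Ioi (0 : ℝ), (ENNReal.ofReal (t ^ (-(s * τ) - 1)) * modulus Ω 1 τ g t ^ τ +
        ENNReal.ofReal (18 / κ) * ∫⁻ x in Ω, ENNReal.ofReal (t ^ (-(s * τ) - 1)) *
          (‖f x - g x‖ₑ ^ τ * jumpWeight V t x)) := by
        refine lintegral_mono fun t => ?_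
        refine (mul_le_mul_right
          (hT.modulus_rpow_le hκ hκ1 hΩ hf hg hfc hτ hτ1 t) _).trans_eq ?_
        rw [lintegral_const_mul' _ _ ofReal_ne_top]
        ring
    _ = _ := by
        rw [lintegral_add_right _ ((hF.lintegral_prod_right').const_mul _),
          lintegral_const_mul' _ _ ofReal_ne_top]
    _ ≤ _ := by
        rw [mul_assoc]
        gcongr

theorem tan_div_one_add_tan_mem_Ioc {β : ℝ} (hβ : 0 < β) (hβ' : β ≤ Real.pi / 3) :
    Real.tan β / (1 + Real.tan β) ∈ Ioc (0 : ℝ) 1 := by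
  have htan : 0 < Real.tan β :=
    Real.tan_pos_of_pos_of_lt_pi_div_two hβ (by linarith [Real.pi_pos])
  refine ⟨by positivity, ?_⟩
  rw [div_le_one (by positivity)]
  linarith

theorem IsSpline.exists_isTiling {N₀ : ℕ} {c₀ β : ℝ} (hβ : 0 < β) (hβ' : β ≤ Real.pi / 3)
    {n : ℕ} {Ω : Set Plane} (hΩ : IsCompact Ω) {S : Plane → ℝ}
    (hS : IsSpline N₀ c₀ β n 1 Ω S) :
    ∃ (V : Finset Plane) (R : Fin n → Set Plane) (c : Fin n → ℝ), V.card ≤ 2 * (4 * N₀) * n ∧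
      IsTiling (Real.tan β / (1 + Real.tan β)) (4 * N₀) Ω V R ∧ Measurable S ∧
      ∀ j, ∀ x ∈ interior (R j), S x = c j := by
  obtain ⟨R, P, hR, hdisj, hun, hdeg, rfl, -⟩ := hS
  have hΩ' : ⋃ j, R j = Ω := hun.resolve_right fun h => noncompact_univ Plane (h.1 ▸ hΩ)
  obtain ⟨V, hV, hT⟩ := _root_.exists_isTiling (fun j => (hR j).hasEdges hβ hβ') hdisj
  obtain ⟨hκ, hκ1⟩ := tan_div_one_add_tan_mem_Ioc hβ hβ'
  have heval : ∀ j (y : Plane), MvPolynomial.eval (fun i => y i) (P j) = (P j).coeff 0 := by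
    intro j y
    rw [MvPolynomial.totalDegree_eq_zero_iff_eq_C.1 (Nat.lt_one_iff.1 (hdeg j))]
    simp
  simp_rw [heval]
  refine ⟨V, R, fun j => (P j).coeff 0, hV, hΩ' ▸ hT, ?_, fun j x hx => ?_⟩
  · exact Finset.measurable_sum _ fun j _ =>
      measurable_const.indicator (hT.isClosed j).measurableSet
  · simp only
    rw [Finset.sum_eq_single j, indicator_of_mem (interior_subset hx)]
    · exact fun i _ hij => indicator_of_notMem
        (hT.interior_inter_eq_empty hκ hκ1 hij.symm hx) _
    · simp
theorem exists_bernstein_constant (N₀ : ℕ) {c₀ β : ℝ} (hβ : 0 < β) (hβ' : β ≤ Real.pi / 3)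
    {p s τ : ℝ} (hp : 0 < p) (hs : 0 < s) (hs2 : s < 2 / p) (hτ : 1 / τ = s / 2 + 1 / p)
    (hτ1 : τ < 1) :
    ∃ C : ℝ≥0∞, C ≠ ⊤ ∧ ∀ (Ω : Set Plane) (n : ℕ) (S₁ S₂ : Plane → ℝ), IsCompact Ω →
      IsSpline N₀ c₀ β n 1 Ω S₁ → IsSpline N₀ c₀ β n 1 Ω S₂ →
      besovSeminorm Ω 1 s τ S₁ ^ τ ≤ besovSeminorm Ω 1 s τ S₂ ^ τ +
        C * (n : ℝ≥0∞) ^ (τ * s / 2) * lpNormE p Ω (fun x => S₁ x - S₂ x) ^ τ := by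
  have hτ0 : 0 < τ := one_div_pos.1 (hτ ▸ by positivity)
  have hτp : τ / p = 1 - s * τ / 2 := by
    field_simp at hτ ⊢
    linarith
  have hθ : 0 < s * τ := by positivity
  have hθ1 : s * τ < 1 := by
    have : s / 2 < 1 / p := by
      rw [lt_div_iff₀ hp] at hs2 ⊢
      linarith
    have := (mul_lt_mul_of_pos_left this hτ0)
    rw [mul_one_div, hτp] at this
    linarith
  obtain ⟨hκ, hκ1⟩ := tan_div_one_add_tan_mem_Ioc hβ hβ'
  obtain ⟨A, hA, hbesov⟩ := exists_besovSeminorm_rpow_le hκ hκ1 hτ0 hτ1.le hθ hθ1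
  obtain ⟨B, hB, hweight⟩ := exists_lintegral_weight_le hκ hκ1 hθ hθ1
  refine ⟨A * B * ((16 * N₀ + 1 : ℕ) : ℝ≥0∞) ^ (τ * s / 2), mul_ne_top (mul_ne_top hA hB)
    (ENNReal.rpow_ne_top_of_nonneg (by positivity) (natCast_ne_top _)), ?_⟩
  intro Ω n f g hΩ hf hg
  obtain ⟨V, R, a, hVn, hR, hfm, hfa⟩ := hf.exists_isTiling hβ hβ' hΩ
  obtain ⟨W, Q, b, hWn, hQ, hgm, hgb⟩ := hg.exists_isTiling hβ hβ' hΩ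
  set U : Finset Plane := insert 0 (V ∪ W) with hU
  have hVU : V ⊆ U := Finset.subset_union_left.trans (Finset.subset_insert _ _)
  have hWU : W ⊆ U := Finset.subset_union_right.trans (Finset.subset_insert _ _)
  refine (hbesov _ _ Ω U R f g a (hR.mono hVU) hΩ.isClosed hfm hgm hfa).trans
    (add_le_add_right ?_ _)
  rcases n.eq_zero_or_pos with rfl | hn
  · have : Ω = ∅ := by rw [← hR.iUnion_eq, iUnion_of_empty]
    simp [this]
  have hcard : U.card ≤ (16 * N₀ + 1) * n := by
    have h1 := Finset.card_insert_le (0 : Plane) (V ∪ W)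
    have h2 := Finset.card_union_le V W
    nlinarith
  have hcard' : (U.card : ℝ≥0∞) ^ (s * τ / 2) ≤
      ((16 * N₀ + 1 : ℕ) : ℝ≥0∞) ^ (τ * s / 2) * (n : ℝ≥0∞) ^ (τ * s / 2) := by
    rw [← ENNReal.mul_rpow_of_nonneg _ _ (by positivity), mul_comm s τ]
    exact ENNReal.rpow_le_rpow (mod_cast hcard) (by positivity)
  have hnorm : (∫⁻ x in Ω, (‖f x - g x‖ₑ ^ τ) ^ (1 - s * τ / 2)⁻¹) ^ (1 - s * τ / 2) =
      lpNormE p Ω (fun x => f x - g x) ^ τ := by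
    simp_rw [← hτp, ← ENNReal.rpow_mul, inv_div, mul_div_cancel₀ p hτ0.ne']
    rw [← lpNormE_rpow hp, ← ENNReal.rpow_mul, mul_div_cancel₀ τ hp.ne']
  have hmain := hweight _ n n Ω U R Q (fun x => ‖f x - g x‖ₑ ^ τ)
    (fun i j => ‖a i - b j‖ₑ ^ τ) (hR.mono hVU) (hQ.mono hWU) (Finset.insert_nonempty _ _)
    hΩ.isBounded hΩ.measurableSet (by fun_prop)
    (fun i j x hi hj => by rw [hfa i x hi, hgb j x hj])
  rw [hnorm] at hmain
  calc _ ≤ A * (B * (((16 * N₀ + 1 : ℕ) : ℝ≥0∞) ^ (τ * s / 2) * (n : ℝ≥0∞) ^ (τ * s / 2)) *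
        lpNormE p Ω (fun x => f x - g x) ^ τ) := by
        gcongr
        exact hmain.trans (by gcongr)
    _ = _ := by ring

/-- **Bernstein-type estimate for piecewise constants, case `τ < 1`.** -/
theorem bernstein_diff_piecewise_constants_tau_lt_one (N₀ : ℕ) (c₀ β : ℝ) (hc₀ : 1 ≤ c₀) (hβ : 0 < β) (hβ' : β ≤ Real.pi / 3)
    (p s τ : ℝ) (hp : 0 < p) (hs : 0 < s) (hs2 : s < 2 / p) (hτ : 1 / τ = s / 2 + 1 / p)
    (hτ1 : τ < 1) :
    ∃ c : ℝ, 0 < c ∧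
      ∀ (Ω : Set Plane) (n₀ : ℕ), IsCompact Ω → IsRingDecomp N₀ c₀ β n₀ Ω →
        ∀ n : ℕ, n₀ ≤ n → ∀ S₁ S₂ : Plane → ℝ,
          IsSpline N₀ c₀ β n 1 Ω S₁ → IsSpline N₀ c₀ β n 1 Ω S₂ →
          besovSeminorm Ω 1 s τ S₁ ^ τ ≤
            besovSeminorm Ω 1 s τ S₂ ^ τ +
              ENNReal.ofReal (c * (n : ℝ) ^ (τ * s / 2)) *
                lpNormE p Ω (fun x => S₁ x - S₂ x) ^ τ := by
  have hτ0 : 0 < τ := one_div_pos.1 (hτ ▸ by positivity)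
  obtain ⟨C, hC, h⟩ := exists_bernstein_constant N₀ (c₀ := c₀) hβ hβ' hp hs hs2 hτ hτ1
  refine ⟨C.toReal + 1, by positivity, fun Ω _ hΩ _ n _ S₁ S₂ h₁ h₂ => ?_⟩
  refine (h Ω n S₁ S₂ hΩ h₁ h₂).trans (add_le_add_right (mul_le_mul_left ?_ _) _)
  rw [ENNReal.ofReal_mul (by positivity),
    ← ENNReal.ofReal_rpow_of_nonneg n.cast_nonneg (by positivity), ENNReal.ofReal_natCast]
  gcongr
  exact (ENNReal.ofReal_toReal hC).symm.trans_le (ENNReal.ofReal_le_ofReal (by linarith))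

end
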